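/- arXiv:1604.08361 — 3 statements merged into one kernel-verified Lean document; each statement's English description precedes it below -/
import Mathlib

section
/- Fix n ≥ 1 and let Sym_n(ℝ) denote the real vector space of symmetric n×n real matrices. The set of quadratic forms Q on Sym_n(ℝ) satisfying Q(ξξᵀ) = 0 for every ξ ∈ ℝⁿ is a linear subspace of the space of all quadratic forms on Sym_n(ℝ), and its dimension equals n²(n²−1)/12. -/
/-- The space `Sym_n(ℝ)` of symmetric `n × n` real matrices, as a submodule of all
`n × n` real matrices. -/
def symMat (n : ℕ) : Submodule ℝ (Matrix (Fin n) (Fin n) ℝ) where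
  carrier := {A | A.IsSymm}
  add_mem' := by
    intro A B hA hB
    simp only [Set.mem_setOf_eq, Matrix.IsSymm] at *
    rw [Matrix.transpose_add, hA, hB]
  zero_mem' := by
    simp only [Set.mem_setOf_eq, Matrix.IsSymm, Matrix.transpose_zero]
  smul_mem' := by
    intro c A hA
    simp only [Set.mem_setOf_eq, Matrix.IsSymm] at *
    rw [Matrix.transpose_smul, hA]

/-- A finite linear combination of monomials, given by multisets of variables, vanishes at every
point iff its coefficients sum to zero over each monomial. -/
theorem mapDomain_eq_zero_iff_forall_sum_prod_eq_zero {R σ Z : Type*} [CommRing R] [IsDomain R]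
    [Infinite R] (e : Z → Multiset σ) (c : Z →₀ R) :
    c.mapDomain e = 0 ↔ ∀ x : σ → R, (c.sum fun z a => a * ((e z).map x).prod) = 0 := by
  classical
  have key (d : Multiset σ →₀ R) (x : σ → R) :
      MvPolynomial.eval x (d.sum fun m a => MvPolynomial.monomial m.toFinsupp a) =
        d.sum fun m a => a * (m.map x).prod := by
    simp [Finsupp.sum, MvPolynomial.eval_monomial, Finsupp.prod, Finset.prod_multiset_map_count]
  have hsum (x : σ → R) : (c.sum fun z a => a * ((e z).map x).prod) =
      (c.mapDomain e).sum fun m a => a * (m.map x).prod := by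
    rw [Finsupp.sum_mapDomain_index (fun _ => zero_mul _) fun _ _ _ => add_mul _ _ _]
  refine ⟨fun h x => by simp [hsum, h], fun h => ?_⟩
  have hp : ((c.mapDomain e).sum fun m a =>
      MvPolynomial.monomial (R := R) m.toFinsupp a) = 0 :=
    MvPolynomial.funext fun x => by rw [key, ← hsum, h, map_zero]
  ext m
  have hm := congrArg (MvPolynomial.coeff m.toFinsupp) hp
  simpa [Finsupp.sum, MvPolynomial.coeff_sum, MvPolynomial.coeff_monomial] using hm

theorem Sym2.toMultiset_injective {α : Type*} :
    Function.Injective (Sym2.toMultiset : Sym2 α → Multiset α) := by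
  intro z w h
  apply (Sym2.equivSym α).injective
  obtain ⟨a, b⟩ := z
  obtain ⟨c, d⟩ := w
  exact Subtype.ext h

section QuadraticForm

variable {R V ι : Type*} [CommRing R] [AddCommGroup V] [Module R V]

/-- The product of two coordinate functions of a basis, as a quadratic form. -/
noncomputable def QuadraticMap.coordMul (b : Module.Basis ι R V) (z : Sym2 ι) :
    QuadraticForm R V :=
  Sym2.lift ⟨fun p q => QuadraticMap.linMulLin (b.coord p) (b.coord q),
    fun _ _ => QuadraticMap.ext fun _ => mul_comm _ _⟩ z

theorem QuadraticMap.coordMul_apply (b : Module.Basis ι R V) (z : Sym2 ι) (v : V) :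
    QuadraticMap.coordMul b z v = (z.toMultiset.map (b.repr v)).prod := by
  obtain ⟨p, q⟩ := z
  change b.coord p v * b.coord q v = (Multiset.map (b.repr v) {p, q}).prod
  simp

theorem QuadraticMap.linearCombination_coordMul_apply (b : Module.Basis ι R V)
    (c : Sym2 ι →₀ R) (v : V) :
    Finsupp.linearCombination R (QuadraticMap.coordMul b) c v =
      c.sum fun z a => a * (z.toMultiset.map (b.repr v)).prod := by
  simp [Finsupp.linearCombination_apply, Finsupp.sum, QuadraticMap.coordMul_apply]

/-- The products of pairs of coordinate functions form a basis of the space of quadratic forms. -/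
noncomputable def QuadraticMap.coordMulBasis [IsDomain R] [Infinite R] [Invertible (2 : R)]
    [Finite ι] (b : Module.Basis ι R V) : Module.Basis (Sym2 ι) R (QuadraticForm R V) :=
  Module.Basis.mk (v := QuadraticMap.coordMul b)
    (by
      rw [linearIndependent_iff]
      intro c hc
      apply Finsupp.mapDomain_injective Sym2.toMultiset_injective
      rw [Finsupp.mapDomain_zero, mapDomain_eq_zero_iff_forall_sum_prod_eq_zero]
      intro x
      have := DFunLike.congr_fun hc (b.equivFun.symm x)
      have hx : (b.repr (b.equivFun.symm x) : ι → R) = x := b.equivFun.apply_symm_apply x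
      rw [QuadraticMap.linearCombination_coordMul_apply, hx] at this
      exact this)
    (by
      have := Fintype.ofFinite ι
      intro Q _
      have hQ : Q = ∑ p, ∑ q, QuadraticMap.associated Q (b p) (b q) •
          QuadraticMap.coordMul b s(p, q) := by
        ext v
        rw [← QuadraticMap.associated_eq_self_apply R Q v]
        conv_lhs => rw [← b.sum_repr v]
        simp only [map_sum, LinearMap.sum_apply, map_smul, LinearMap.smul_apply,
          sum_apply, smul_apply, Finset.mul_sum, smul_eq_mul]
        rw [Finset.sum_comm]
        refine Finset.sum_congr rfl fun p _ => Finset.sum_congr rfl fun q _ => ?_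
        change _ = _ * (b.repr v p * b.repr v q)
        ring
      rw [hQ]
      exact Submodule.sum_mem _ fun p _ => Submodule.sum_mem _ fun q _ =>
        Submodule.smul_mem _ _ (Submodule.subset_span ⟨_, rfl⟩))

theorem QuadraticMap.apply_eq_sum_coordMulBasis_repr [IsDomain R] [Infinite R]
    [Invertible (2 : R)] [Finite ι] (b : Module.Basis ι R V) (Q : QuadraticForm R V) (v : V) :
    Q v = ((QuadraticMap.coordMulBasis b).repr Q).sum
      fun z a => a * (z.toMultiset.map (b.repr v)).prod := by
  rw [← QuadraticMap.linearCombination_coordMul_apply]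
  conv_lhs => rw [← (QuadraticMap.coordMulBasis b).linearCombination_repr Q]
  simp [QuadraticMap.coordMulBasis]

end QuadraticForm

/-- The union of the two members of a pair of unordered pairs. -/
def Sym2.flatten {α : Type*} (z : Sym2 (Sym2 α)) : Sym α 4 :=
  ⟨z.toMultiset.bind Sym2.toMultiset, by
    obtain ⟨p, q⟩ := z
    change (Multiset.bind {p, q} Sym2.toMultiset).card = 4
    simp [Sym2.card_toMultiset]⟩

theorem Sym2.flatten_surjective {α : Type*} :
    Function.Surjective (Sym2.flatten : Sym2 (Sym2 α) → Sym α 4) := by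
  rintro ⟨⟨l⟩, hl⟩
  obtain ⟨a, b, c, d, rfl⟩ := List.length_eq_four.mp hl
  exact ⟨s(s(a, b), s(c, d)), rfl⟩

/-- A symmetric matrix is a function on unordered pairs of indices. -/
def symMatEquivFun (n : ℕ) : symMat n ≃ₗ[ℝ] (Sym2 (Fin n) → ℝ) where
  toFun A := Sym2.lift ⟨fun i j => A.1 i j, fun i j => A.2.apply j i⟩
  map_add' A B := by ext ⟨i, j⟩; rfl
  map_smul' c A := by ext ⟨i, j⟩; rfl
  invFun f := ⟨Matrix.of fun i j => f s(i, j), by ext i j; simp [Sym2.eq_swap]⟩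
  left_inv A := by ext i j; rfl
  right_inv f := by ext ⟨i, j⟩; rfl

/-- The basis of the symmetric matrices indexed by unordered pairs of indices. -/
noncomputable def symMatBasis (n : ℕ) : Module.Basis (Sym2 (Fin n)) ℝ (symMat n) :=
  Module.Basis.ofEquivFun (symMatEquivFun n)

theorem symMatBasis_repr_of_eq_vecMulVec {n : ℕ} {ξ : Fin n → ℝ} {A : symMat n}
    (hA : (A : Matrix (Fin n) (Fin n) ℝ) = Matrix.vecMulVec ξ ξ) (p : Sym2 (Fin n)) :
    (symMatBasis n).repr A p = (p.toMultiset.map ξ).prod := by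
  obtain ⟨i, j⟩ := p
  change (A : Matrix (Fin n) (Fin n) ℝ) i j = (Multiset.map ξ {i, j}).prod
  simp [hA, Matrix.vecMulVec_apply]

/-- Restriction of a quadratic form on symmetric matrices to the rank-one cone, as a quartic. -/
noncomputable def rankOneQuartic (n : ℕ) :
    QuadraticForm ℝ (symMat n) →ₗ[ℝ] (Sym (Fin n) 4 →₀ ℝ) :=
  Finsupp.lmapDomain ℝ ℝ Sym2.flatten ∘ₗ
    (QuadraticMap.coordMulBasis (symMatBasis n)).repr.toLinearMap

theorem rankOneQuartic_eq_zero_iff {n : ℕ} (Q : QuadraticForm ℝ (symMat n)) :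
    rankOneQuartic n Q = 0 ↔ ∀ (ξ : Fin n → ℝ) (A : symMat n),
      (A : Matrix (Fin n) (Fin n) ℝ) = Matrix.vecMulVec ξ ξ → Q A = 0 := by
  set c := (QuadraticMap.coordMulBasis (symMatBasis n)).repr Q
  have hQ (ξ : Fin n → ℝ) (A : symMat n)
      (hA : (A : Matrix (Fin n) (Fin n) ℝ) = Matrix.vecMulVec ξ ξ) :
      Q A = c.sum fun z a => a * (((Sym2.flatten z : Sym (Fin n) 4) : Multiset _).map ξ).prod := by
    rw [QuadraticMap.apply_eq_sum_coordMulBasis_repr (symMatBasis n)]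
    refine Finsupp.sum_congr fun z _ => ?_
    change _ = _ * (Multiset.map ξ (z.toMultiset.bind Sym2.toMultiset)).prod
    rw [Multiset.map_bind, Multiset.prod_bind]
    simp only [symMatBasis_repr_of_eq_vecMulVec hA]
  have h0 : rankOneQuartic n Q = 0 ↔
      c.mapDomain (fun z => ((Sym2.flatten z : Sym (Fin n) 4) : Multiset (Fin n))) = 0 := by
    rw [show (fun z => ((Sym2.flatten z : Sym (Fin n) 4) : Multiset (Fin n))) =
      Sym.toMultiset ∘ Sym2.flatten from rfl, Finsupp.mapDomain_comp,
      ← (Finsupp.mapDomain_injective Sym.coe_injective).eq_iff, Finsupp.mapDomain_zero]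
    rfl
  rw [h0, mapDomain_eq_zero_iff_forall_sum_prod_eq_zero]
  constructor
  · intro h ξ A hA
    rw [hQ ξ A hA, h]
  · intro h ξ
    have hs : (Matrix.vecMulVec ξ ξ).IsSymm := by
      ext i j
      simp [Matrix.vecMulVec_apply, mul_comm]
    rw [← hQ ξ ⟨Matrix.vecMulVec ξ ξ, hs⟩ rfl]
    exact h ξ _ rfl

theorem choose_pairs_eq_add_choose_quadruples (n : ℕ) :
    ((n + 1).choose 2 + 1).choose 2 = n ^ 2 * (n ^ 2 - 1) / 12 + (n + 4 - 1).choose 4 := by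
  obtain _ | m := n
  · rfl
  have h1 := Nat.descFactorial_eq_factorial_mul_choose (m + 2) 2
  have h2 := Nat.descFactorial_eq_factorial_mul_choose ((m + 2).choose 2 + 1) 2
  have h3 := Nat.descFactorial_eq_factorial_mul_choose (m + 4) 4
  simp only [Nat.succ_descFactorial_succ, Nat.descFactorial_zero, Nat.descFactorial_one,
    Nat.factorial, mul_one] at h1 h2 h3
  have h4 : (m + 1) ^ 2 - 1 = m ^ 2 + 2 * m := by
    rw [show (m + 1) ^ 2 = m ^ 2 + 2 * m + 1 by ring, Nat.add_sub_cancel]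
  rw [h4, show m + 1 + 1 = m + 2 from rfl, show m + 1 + 4 - 1 = m + 4 by omega]
  have h5 : (m + 1) ^ 2 * (m ^ 2 + 2 * m) + 12 * (m + 4).choose 4 =
      12 * ((m + 2).choose 2 + 1).choose 2 := by
    nlinarith
  omega

/-- the quadratic forms on `Sym_n(ℝ)` vanishing on all rank-one squares
`ξξᵀ` form a linear subspace of the space of all quadratic forms on `Sym_n(ℝ)`, of
dimension `n²(n²−1)/12`. -/
theorem dim_quadraticForms_vanishing_on_rank_one_cone (n : ℕ) (hn : 1 ≤ n) :
    ∃ S : Submodule ℝ (QuadraticForm ℝ (symMat n)),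
      (S : Set (QuadraticForm ℝ (symMat n))) =
        {Q | ∀ (ξ : Fin n → ℝ) (A : symMat n),
          (A : Matrix (Fin n) (Fin n) ℝ) = Matrix.vecMulVec ξ ξ → Q A = 0} ∧
      Module.rank ℝ ↥S = (n ^ 2 * (n ^ 2 - 1) / 12 : ℕ) := by
  refine ⟨LinearMap.ker (rankOneQuartic n), Set.ext fun Q => rankOneQuartic_eq_zero_iff Q, ?_⟩
  have h := (Finsupp.lmapDomain ℝ ℝ (Sym2.flatten (α := Fin n))).finrank_range_add_finrank_ker
  rw [LinearMap.range_eq_top.mpr (Finsupp.mapDomain_surjective Sym2.flatten_surjective),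
    finrank_top, Module.finrank_finsupp_self, Module.finrank_finsupp_self,
    Sym.card_sym_eq_choose, Sym2.card, Sym2.card, Fintype.card_fin,
    choose_pairs_eq_add_choose_quadruples] at h
  rw [rankOneQuartic, LinearMap.ker_comp,
    ((QuadraticMap.coordMulBasis (symMatBasis n)).repr.ofSubmodule' _).rank_eq,
    ← Module.finrank_eq_rank, Nat.cast_inj]
  omega
end

section
/- Fix integers n ≥ 1 and r ≥ 1, and let f : Matrix(n,n,ℝ) → ℝ be a smooth function. Then the following are equivalent: (i) for every symmetric n×n real matrix A and every ξ ∈ ℝⁿ, the function t ↦ f(A + t·ξξᵀ) from ℝ to ℝ is a polynomial function of degree at most r (equivalently, its (r+1)-st derivative vanishes identically); (ii) there exist finitely many real coefficients c_α and, for each α, an integer m_α with 0 ≤ m_α ≤ r together with index subsets I_{α,1}, J_{α,1}, …, I_{α,m_α}, J_{α,m_α} of {1,…,n} with |I_{α,j}| = |J_{α,j}| for all j, such that for every symmetric n×n real matrix A one has f(A) = Σ_α c_α · ∏_{j=1}^{m_α} det(A_{I_{α,j}, J_{α,j}}) (the empty product, m_α = 0, being the constant 1). -/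
namespace RankOneMinors

open MvPolynomial Matrix

section Fischer

variable {σ : Type*} [Fintype σ]

/-- The Fischer pairing `⟨p, q⟩ = p(∂) q |₀` on real polynomials, in which monomials are orthogonal
and `⟨X ^ m, X ^ m⟩ = ∏ i, (m i)!`. -/
noncomputable def fischer : MvPolynomial σ ℝ →ₗ[ℝ] MvPolynomial σ ℝ →ₗ[ℝ] ℝ :=
  (basisMonomials σ ℝ).constr ℝ fun m => (∏ i, ((m i).factorial : ℝ)) • lcoeff ℝ m

theorem fischer_monomial (m : σ →₀ ℕ) (a : ℝ) (q : MvPolynomial σ ℝ) :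
    fischer (monomial m a) q = a * ((∏ i, ((m i).factorial : ℝ)) * coeff m q) := by
  have h : monomial m a = a • basisMonomials σ ℝ m := by
    simp [coe_basisMonomials, smul_monomial]
  rw [h, map_smul, fischer, Module.Basis.constr_basis]
  simp [lcoeff]

theorem fischer_X_mul (i : σ) (p q : MvPolynomial σ ℝ) :
    fischer (X i * p) q = fischer p (pderiv i q) := by
  classical
  induction p using MvPolynomial.induction_on' with
  | add p₁ p₂ h₁ h₂ => simp [mul_add, h₁, h₂]
  | monomial m a =>
    have h : X i * monomial m a = monomial (m + Finsupp.single i 1) a := by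
      rw [X, monomial_mul, one_mul, add_comm]
    have hprod : ∏ j, (((m + Finsupp.single i 1 : σ →₀ ℕ) j).factorial : ℝ) =
        (m i + 1) * ∏ j, ((m j).factorial : ℝ) := by
      rw [← Finset.mul_prod_erase _ _ (Finset.mem_univ i),
        ← Finset.mul_prod_erase _ (fun j => ((m j).factorial : ℝ)) (Finset.mem_univ i), ← mul_assoc]
      congr 1
      · simp [Nat.factorial_succ]
      · refine Finset.prod_congr rfl fun j hj => ?_
        simp [(Finset.ne_of_mem_erase hj).symm]
    rw [h, fischer_monomial, fischer_monomial, coeff_pderiv, hprod]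
    ring

theorem fischer_self_eq_zero {p : MvPolynomial σ ℝ} (h : fischer p p = 0) : p = 0 := by
  have hs : fischer p p = ∑ m ∈ p.support, (∏ i, ((m i).factorial : ℝ)) * coeff m p ^ 2 := by
    conv_lhs => enter [1]; rw [p.as_sum, map_sum]
    rw [LinearMap.sum_apply]
    refine Finset.sum_congr rfl fun m _ => ?_
    rw [fischer_monomial]
    ring
  rw [hs, Finset.sum_eq_zero_iff_of_nonneg fun m _ => by positivity] at h
  ext m
  by_contra hm
  have := h m (mem_support_iff.2 hm)
  have hpos : (∏ i, ((m i).factorial : ℝ)) ≠ 0 :=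
    Finset.prod_ne_zero_iff.2 fun i _ => by positivity
  exact hm (by simpa [hpos] using this)

/-- Linear change of variables `X i ↦ ∑ j, L i j * X j`. -/
noncomputable def linSubst (L : Matrix σ σ ℝ) : MvPolynomial σ ℝ →ₐ[ℝ] MvPolynomial σ ℝ :=
  aeval fun i => ∑ j, C (L i j) * X j

theorem pderiv_linSubst (L : Matrix σ σ ℝ) (i : σ) (p : MvPolynomial σ ℝ) :
    pderiv i (linSubst L p) = ∑ j, C (L j i) * linSubst L (pderiv j p) := by
  classical
  induction p using MvPolynomial.induction_on with
  | C a => simp [linSubst]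
  | add p q hp hq => simp [hp, hq, mul_add, Finset.sum_add_distrib]
  | mul_X p k hp =>
    have hX : pderiv i (linSubst L (X k)) = C (L k i) := by
      simp [linSubst, Pi.single_apply]
    simp only [map_mul, pderiv_mul, hp, hX, map_add, mul_add, Finset.sum_add_distrib,
      Finset.sum_mul, pderiv_X]
    congr 1
    · exact Finset.sum_congr rfl fun j _ => by ring
    · rw [Finset.sum_eq_single k]
      · simp [mul_comm]
      · intro j _ hj
        simp [hj.symm]
      · simp

theorem fischer_linSubst (L : Matrix σ σ ℝ) (p q : MvPolynomial σ ℝ) :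
    fischer (linSubst L p) q = fischer p (linSubst Lᵀ q) := by
  induction p using MvPolynomial.induction_on generalizing q with
  | C a =>
    have h : coeff 0 (linSubst Lᵀ q) = coeff 0 q := by
      simp only [← constantCoeff_eq, linSubst]
      induction q using MvPolynomial.induction_on with
      | C a => simp
      | add p q hp hq => rw [map_add, map_add, hp, hq, map_add]
      | mul_X p k hp => simp
    rw [show linSubst L (C a) = C a by simp [linSubst], ← monomial_zero', fischer_monomial,
      fischer_monomial, h]
  | add p₁ p₂ h₁ h₂ => simp [h₁, h₂]
  | mul_X p k hp =>
    rw [mul_comm p, fischer_X_mul, pderiv_linSubst, map_mul]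
    have hX : linSubst L (X k) = ∑ j, C (L k j) * X j := by simp [linSubst]
    rw [hX, Finset.sum_mul, map_sum, map_sum, LinearMap.sum_apply]
    refine Finset.sum_congr rfl fun j _ => ?_
    rw [mul_assoc, C_mul', C_mul', map_smul, map_smul, LinearMap.smul_apply, fischer_X_mul, hp,
      transpose_apply]

/-- Orthogonal decomposition with respect to the Fischer pairing along a finite-dimensional
subspace. -/
theorem exists_sub_orthogonal (M : Submodule ℝ (MvPolynomial σ ℝ)) (hM : M.FG)
    (p : MvPolynomial σ ℝ) : ∃ m ∈ M, ∀ m' ∈ M, fischer m' (p - m) = 0 := by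
  have : FiniteDimensional ℝ M := Module.Finite.iff_fg.2 hM
  let T : M →ₗ[ℝ] Module.Dual ℝ M := (fischer.flip.domRestrict₂ M).domRestrict M
  have hT : ∀ m m' : M, T m m' = fischer (m' : MvPolynomial σ ℝ) m := fun _ _ => rfl
  have hinj : Function.Injective T := by
    rw [injective_iff_map_eq_zero]
    intro m hm
    have := hT m m
    rw [hm] at this
    exact Subtype.ext (fischer_self_eq_zero this.symm)
  have hsurj : Function.Surjective T :=
    (LinearMap.injective_iff_surjective_of_finrank_eq_finrank
      Subspace.dual_finrank_eq.symm).1 hinj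
  obtain ⟨m, hm⟩ := hsurj ((fischer.flip p).domRestrict M)
  refine ⟨m, m.2, fun m' hm' => ?_⟩
  have h := LinearMap.congr_fun hm ⟨m', hm'⟩
  rw [hT] at h
  simp only [LinearMap.domRestrict_apply, LinearMap.flip_apply] at h
  rw [map_sub, h, sub_self]

end Fischer

section Congruence

variable {n : ℕ}

/-- Evaluation of a polynomial in the matrix entries at a real matrix. -/
noncomputable def evalAt (X : Matrix (Fin n) (Fin n) ℝ) :
    MvPolynomial (Fin n × Fin n) ℝ →ₐ[ℝ] ℝ :=
  aeval fun ij => X ij.1 ij.2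

theorem evalAt_ext {p q : MvPolynomial (Fin n × Fin n) ℝ} (h : ∀ X, evalAt X p = evalAt X q) :
    p = q := by
  refine MvPolynomial.funext fun x => ?_
  have := h (Matrix.of fun i j => x (i, j))
  simpa [evalAt, aeval_eq_eval] using this

/-- The action of a matrix `g` on polynomials in the matrix entries induced by `X ↦ gᵀ X g`. -/
noncomputable def congrAct (g : Matrix (Fin n) (Fin n) ℝ) :
    MvPolynomial (Fin n × Fin n) ℝ →ₐ[ℝ] MvPolynomial (Fin n × Fin n) ℝ :=
  linSubst (Matrix.of fun ij kl => g kl.1 ij.1 * g kl.2 ij.2)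

theorem evalAt_congrAct (g X : Matrix (Fin n) (Fin n) ℝ) (p : MvPolynomial (Fin n × Fin n) ℝ) :
    evalAt X (congrAct g p) = evalAt (gᵀ * X * g) p := by
  have h : (evalAt X).comp (congrAct g) = evalAt (gᵀ * X * g) := by
    refine MvPolynomial.algHom_ext fun ij => ?_
    simp only [AlgHom.comp_apply, congrAct, linSubst, evalAt, aeval_X, map_sum, map_mul, algHom_C,
      Matrix.of_apply, Matrix.mul_apply, Finset.sum_mul, transpose_apply,
      Fintype.sum_prod_type_right, Algebra.algebraMap_self, RingHom.id_apply]
    exact Finset.sum_congr rfl fun k _ => Finset.sum_congr rfl fun l _ => by ring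
  exact DFunLike.congr_fun h p

theorem fischer_congrAct (g : Matrix (Fin n) (Fin n) ℝ)
    (p q : MvPolynomial (Fin n × Fin n) ℝ) :
    fischer p (congrAct g q) = fischer (congrAct gᵀ p) q :=
  (fischer_linSubst _ p q).symm

/-- The symmetric part of a real matrix. -/
noncomputable def symPart (X : Matrix (Fin n) (Fin n) ℝ) : Matrix (Fin n) (Fin n) ℝ :=
  (1 / 2 : ℝ) • (X + Xᵀ)

theorem isSymm_symPart (X : Matrix (Fin n) (Fin n) ℝ) : (symPart X).IsSymm := by
  simp [symPart, Matrix.IsSymm, add_comm]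

theorem symPart_of_isSymm {X : Matrix (Fin n) (Fin n) ℝ} (h : X.IsSymm) : symPart X = X := by
  rw [symPart, h.eq, ← two_smul ℝ X, smul_smul]
  norm_num

theorem symPart_congr (g X : Matrix (Fin n) (Fin n) ℝ) :
    symPart (gᵀ * X * g) = gᵀ * symPart X * g := by
  simp [symPart, Matrix.mul_add, Matrix.add_mul, Matrix.mul_assoc]

theorem isSymm_vecMulVec_self (ξ : Fin n → ℝ) : (vecMulVec ξ ξ).IsSymm := by
  ext i j
  simp [vecMulVec_apply, mul_comm]

theorem symPart_add_smul_vecMulVec (X : Matrix (Fin n) (Fin n) ℝ) (ξ : Fin n → ℝ) (t : ℝ) :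
    symPart (X + t • vecMulVec ξ ξ) = symPart X + t • vecMulVec ξ ξ := by
  have h : symPart (t • vecMulVec ξ ξ) = t • vecMulVec ξ ξ :=
    symPart_of_isSymm ((isSymm_vecMulVec_self ξ).smul t)
  conv_rhs => rw [← h]
  simp only [symPart, transpose_add, ← smul_add]
  congr 1
  abel

/-- The generic symmetric matrix. -/
noncomputable def genSymm : Matrix (Fin n) (Fin n) (MvPolynomial (Fin n × Fin n) ℝ) :=
  Matrix.of fun i j => C (1 / 2) * (X (i, j) + X (j, i))

theorem map_evalAt_genSymm (X : Matrix (Fin n) (Fin n) ℝ) :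
    (genSymm (n := n)).map (evalAt X) = symPart X := by
  ext i j
  simp [genSymm, evalAt, symPart]

theorem map_congrAct_genSymm (g : Matrix (Fin n) (Fin n) ℝ) :
    (genSymm (n := n)).map (congrAct g) = (g.map C)ᵀ * genSymm * g.map C := by
  refine Matrix.ext fun i j => evalAt_ext fun X => ?_
  have h₁ : evalAt X ((genSymm.map (congrAct g)) i j) = symPart (gᵀ * X * g) i j := by
    rw [map_apply, evalAt_congrAct, ← map_evalAt_genSymm, map_apply]
  have h₂ : ((g.map C)ᵀ * genSymm * g.map C).map (evalAt X) = gᵀ * symPart X * g := by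
    rw [Matrix.map_mul, Matrix.map_mul, map_evalAt_genSymm, transpose_map]
    have : (g.map C).map (evalAt X) = g := by
      ext i j
      simp [evalAt]
    rw [this]
  rw [h₁, symPart_congr, ← h₂, map_apply]

/-- The minor of the generic symmetric matrix with rows `φ` and columns `ψ`. -/
noncomputable def genMinor {k : ℕ} (φ ψ : Fin k → Fin n) : MvPolynomial (Fin n × Fin n) ℝ :=
  (genSymm.submatrix φ ψ).det

theorem evalAt_genMinor {k : ℕ} (φ ψ : Fin k → Fin n) (X : Matrix (Fin n) (Fin n) ℝ) :
    evalAt X (genMinor φ ψ) = ((symPart X).submatrix φ ψ).det := by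
  rw [genMinor, AlgHom.map_det, AlgHom.mapMatrix_apply, ← submatrix_map, map_evalAt_genSymm]

/-- The linear span of the minors of the generic symmetric matrix. -/
noncomputable def minorSpan (n : ℕ) : Submodule ℝ (MvPolynomial (Fin n × Fin n) ℝ) :=
  Submodule.span ℝ (Set.range fun P : {P : Finset (Fin n) × Finset (Fin n) // P.1.card = P.2.card} =>
    genMinor (P.1.1.orderEmbOfFin rfl) (P.1.2.orderEmbOfFin P.2.symm))

theorem minorSpan_fg : (minorSpan n).FG :=
  Submodule.fg_span (Set.finite_range _)

theorem exists_perm_orderEmbOfFin {k : ℕ} {φ : Fin k → Fin n} (hφ : Function.Injective φ) :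
    ∃ (I : Finset (Fin n)) (hI : I.card = k) (e : Equiv.Perm (Fin k)),
      φ = I.orderEmbOfFin hI ∘ e := by
  have hI : (Finset.univ.image φ).card = k := by
    rw [Finset.card_image_of_injective _ hφ, Finset.card_univ, Fintype.card_fin]
  have hmem : ∀ i, ∃ j, (Finset.univ.image φ).orderEmbOfFin hI j = φ i := fun i => by
    have : φ i ∈ Set.range ((Finset.univ.image φ).orderEmbOfFin hI) := by
      rw [Finset.range_orderEmbOfFin]
      simp
    exact this
  choose e he using hmem
  have hinj : Function.Injective e := fun i j h => hφ (by rw [← he i, ← he j, h])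
  exact ⟨_, hI, Equiv.ofBijective e (Finite.injective_iff_bijective.1 hinj),
    funext fun i => (he i).symm⟩

theorem genMinor_orderEmbOfFin_mem {k : ℕ} {I J : Finset (Fin n)} (hI : I.card = k)
    (hJ : J.card = k) : genMinor (I.orderEmbOfFin hI) (J.orderEmbOfFin hJ) ∈ minorSpan n := by
  subst hI
  exact Submodule.subset_span ⟨⟨(I, J), hJ.symm⟩, rfl⟩

theorem genMinor_mem {k : ℕ} (φ ψ : Fin k → Fin n) : genMinor φ ψ ∈ minorSpan n := by
  by_cases hφ : Function.Injective φ
  · by_cases hψ : Function.Injective ψ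
    · obtain ⟨I, hI, e, rfl⟩ := exists_perm_orderEmbOfFin hφ
      obtain ⟨J, hJ, e', rfl⟩ := exists_perm_orderEmbOfFin hψ
      have h : genMinor (I.orderEmbOfFin hI ∘ e) (J.orderEmbOfFin hJ ∘ e') =
          ((Equiv.Perm.sign e' : ℤ) * (Equiv.Perm.sign e : ℤ) : ℝ) •
            genMinor (I.orderEmbOfFin hI) (J.orderEmbOfFin hJ) := by
        rw [genMinor, ← submatrix_submatrix, ← Function.comp_id e, ← Function.id_comp e',
          ← submatrix_submatrix, det_permute', det_permute, smul_eq_C_mul,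
          genMinor, ← mul_assoc]
        simp
      rw [h]
      exact Submodule.smul_mem _ _ (genMinor_orderEmbOfFin_mem hI hJ)
    · obtain ⟨i, j, hij, hne⟩ : ∃ i j, ψ i = ψ j ∧ i ≠ j := by
        simpa [Function.Injective] using hψ
      rw [genMinor, det_zero_of_column_eq hne fun k => by simp [hij]]
      exact Submodule.zero_mem _
  · obtain ⟨i, j, hij, hne⟩ : ∃ i j, φ i = φ j ∧ i ≠ j := by
      simpa [Function.Injective] using hφ
    rw [genMinor, det_zero_of_row_eq hne (by ext; simp [hij])]
    exact Submodule.zero_mem _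

theorem one_mem_minorSpan : 1 ∈ minorSpan n := by
  have h : genMinor (Fin.elim0 : Fin 0 → Fin n) Fin.elim0 = 1 := det_isEmpty
  exact h ▸ genMinor_mem _ _

theorem det_mul_eq_sum {R : Type*} [CommRing R] {k : ℕ} (A : Matrix (Fin k) (Fin n) R)
    (B : Matrix (Fin n) (Fin k) R) :
    (A * B).det = ∑ ψ : Fin k → Fin n, (∏ i, B (ψ i) i) * (A.submatrix id ψ).det := by
  have h : (A * B)ᵀ = fun i => ∑ j, B j i • Aᵀ j := by
    ext i j
    simp [Matrix.mul_apply, mul_comm]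
  rw [← det_transpose, h]
  have := (detRowAlternating (n := Fin k) (R := R)).toMultilinearMap.map_sum
    fun i j => B j i • Aᵀ j
  refine this.trans (Finset.sum_congr rfl fun ψ _ => ?_)
  have h₂ := (detRowAlternating (n := Fin k) (R := R)).toMultilinearMap.map_smul_univ
    (fun i => B (ψ i) i) fun i => Aᵀ (ψ i)
  refine h₂.trans ?_
  rw [smul_eq_mul, ← det_transpose (A.submatrix id ψ)]
  rfl

theorem det_mul_eq_sum' {R : Type*} [CommRing R] {k : ℕ} (A : Matrix (Fin k) (Fin n) R)
    (B : Matrix (Fin n) (Fin k) R) :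
    (A * B).det = ∑ φ : Fin k → Fin n, (∏ i, A i (φ i)) * (B.submatrix φ id).det := by
  rw [← det_transpose, transpose_mul, det_mul_eq_sum]
  refine Finset.sum_congr rfl fun φ _ => ?_
  rw [← det_transpose (B.submatrix φ id)]
  rfl

theorem congrAct_genMinor_mem {k : ℕ} (g : Matrix (Fin n) (Fin n) ℝ) (φ ψ : Fin k → Fin n) :
    congrAct g (genMinor φ ψ) ∈ minorSpan n := by
  have hC : ∀ x : Fin k → ℝ, ∀ p : MvPolynomial (Fin n × Fin n) ℝ,
      (∏ i, C (x i)) * p = (∏ i, x i) • p := fun x p => by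
    rw [smul_eq_C_mul, map_prod]
  have h : ∀ G S : Matrix (Fin n) (Fin n) (MvPolynomial (Fin n × Fin n) ℝ),
      (Gᵀ * S * G).submatrix φ ψ = ((G.submatrix id φ)ᵀ * S) * G.submatrix id ψ :=
    fun _ _ => rfl
  rw [genMinor, AlgHom.map_det, AlgHom.mapMatrix_apply, ← submatrix_map, map_congrAct_genSymm, h,
    det_mul_eq_sum]
  refine Submodule.sum_mem _ fun β _ => ?_
  simp only [submatrix_apply, map_apply, id]
  rw [hC]
  refine Submodule.smul_mem _ _ ?_
  have h₂ : ∀ (G : Matrix (Fin k) (Fin n) (MvPolynomial (Fin n × Fin n) ℝ))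
      (S : Matrix (Fin n) (Fin n) (MvPolynomial (Fin n × Fin n) ℝ)),
      (G * S).submatrix id β = G * S.submatrix id β := fun _ _ => rfl
  rw [h₂, det_mul_eq_sum']
  refine Submodule.sum_mem _ fun α _ => ?_
  simp only [submatrix_apply, transpose_apply, map_apply, id]
  rw [hC]
  exact Submodule.smul_mem _ _ (genMinor_mem α β)

theorem congrAct_mem_minorSpan_pow (g : Matrix (Fin n) (Fin n) ℝ) (r : ℕ)
    {p : MvPolynomial (Fin n × Fin n) ℝ} (hp : p ∈ minorSpan n ^ r) :
    congrAct g p ∈ minorSpan n ^ r := by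
  have h₁ : (minorSpan n).map (congrAct g).toLinearMap ≤ minorSpan n := by
    rw [minorSpan, Submodule.map_span_le]
    rintro _ ⟨P, rfl⟩
    exact congrAct_genMinor_mem g _ _
  have h : (minorSpan n ^ r).map (congrAct g).toLinearMap ≤ minorSpan n ^ r := by
    rw [Submodule.map_pow]
    exact pow_le_pow_left' h₁ r
  exact h (Submodule.mem_map_of_mem hp)

end Congruence

section RankOneKernel

/-- The function `F` is given by a real polynomial of degree at most `d`. -/
def IsPolyOfDegreeLE (d : ℕ) (F : ℝ → ℝ) : Prop :=
  ∃ q : Polynomial ℝ, q.natDegree ≤ d ∧ ∀ t, F t = q.eval t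

namespace IsPolyOfDegreeLE

variable {d e : ℕ} {F G : ℝ → ℝ}

theorem const (c : ℝ) : IsPolyOfDegreeLE d fun _ => c :=
  ⟨Polynomial.C c, by simp, by simp⟩

theorem add (hF : IsPolyOfDegreeLE d F) (hG : IsPolyOfDegreeLE d G) :
    IsPolyOfDegreeLE d fun t => F t + G t := by
  obtain ⟨q, hq, hqF⟩ := hF
  obtain ⟨q', hq', hqG⟩ := hG
  exact ⟨q + q', Polynomial.natDegree_add_le_of_degree_le hq hq', fun t => by simp [hqF, hqG]⟩

theorem mul (hF : IsPolyOfDegreeLE d F) (hG : IsPolyOfDegreeLE e G) :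
    IsPolyOfDegreeLE (d + e) fun t => F t * G t := by
  obtain ⟨q, hq, hqF⟩ := hF
  obtain ⟨q', hq', hqG⟩ := hG
  exact ⟨q * q', Polynomial.natDegree_mul_le_of_le hq hq', fun t => by simp [hqF, hqG]⟩

theorem const_mul (c : ℝ) (hF : IsPolyOfDegreeLE d F) : IsPolyOfDegreeLE d fun t => c * F t := by
  have := (const (d := 0) c).mul hF
  rwa [zero_add] at this

end IsPolyOfDegreeLE

theorem isPolyOfDegreeLE_det_add_smul_vecMulVec {k : ℕ} (B : Matrix (Fin k) (Fin k) ℝ)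
    (u v : Fin k → ℝ) : IsPolyOfDegreeLE 1 fun t => (B + t • vecMulVec u v).det := by
  let N : (Unit ⊕ Fin k → ℝ) → Matrix (Unit ⊕ Fin k) (Unit ⊕ Fin k) ℝ := fun x =>
    (fromBlocks 1 0 (Matrix.of fun i _ => u i) B).updateRow (Sum.inl ()) x
  let x₀ : Unit ⊕ Fin k → ℝ := Sum.elim (fun _ => 1) fun _ => 0
  let x₁ : Unit ⊕ Fin k → ℝ := Sum.elim (fun _ => 0) (-v)
  have hN : ∀ t, (B + t • vecMulVec u v).det =
      (N (x₀ + t • x₁)).det := fun t => by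
    have : N (x₀ + t • x₁) =
        fromBlocks 1 (Matrix.of fun _ j => -(t * v j)) (Matrix.of fun i _ => u i) B := by
      ext (i | i) (j | j) <;> simp [N, x₀, x₁, updateRow_apply]
    rw [this, det_fromBlocks_one₁₁]
    congr 1
    ext i j
    simp [Matrix.mul_apply, vecMulVec_apply]
    ring
  simp only [hN, N, det_updateRow_add, det_updateRow_smul]
  refine (IsPolyOfDegreeLE.const _).add ?_
  exact IsPolyOfDegreeLE.mul (e := 0) ⟨Polynomial.X, Polynomial.natDegree_X_le, by simp⟩
    (IsPolyOfDegreeLE.const _)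

variable {n : ℕ}

/-- Polynomials in the symmetric part of a matrix which have degree at most `r` along every line
in a direction `ξ ξᵀ`. -/
def rankOneKernel (n r : ℕ) : Submodule ℝ (MvPolynomial (Fin n × Fin n) ℝ) where
  carrier := {p | (∀ X, evalAt (symPart X) p = evalAt X p) ∧
    ∀ X ξ, IsPolyOfDegreeLE r fun t => evalAt (X + t • vecMulVec ξ ξ) p}
  zero_mem' := ⟨by simp, fun X ξ => by simpa using IsPolyOfDegreeLE.const 0⟩
  add_mem' {p q} hp hq := ⟨fun X => by rw [map_add, map_add, hp.1, hq.1], fun X ξ => by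
    simpa only [map_add] using (hp.2 X ξ).add (hq.2 X ξ)⟩
  smul_mem' c p hp := ⟨fun X => by rw [map_smul, map_smul, hp.1], fun X ξ => by
    simpa only [map_smul, smul_eq_mul] using (hp.2 X ξ).const_mul c⟩

theorem mul_mem_rankOneKernel {r s : ℕ} {p q : MvPolynomial (Fin n × Fin n) ℝ}
    (hp : p ∈ rankOneKernel n r) (hq : q ∈ rankOneKernel n s) :
    p * q ∈ rankOneKernel n (r + s) :=
  ⟨fun X => by rw [map_mul, map_mul, hp.1, hq.1], fun X ξ => by
    simpa only [map_mul] using (hp.2 X ξ).mul (hq.2 X ξ)⟩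

theorem genMinor_mem_rankOneKernel {k : ℕ} (φ ψ : Fin k → Fin n) :
    genMinor φ ψ ∈ rankOneKernel n 1 := by
  refine ⟨fun X => ?_, fun X ξ => ?_⟩
  · rw [evalAt_genMinor, evalAt_genMinor, symPart_of_isSymm (isSymm_symPart X)]
  · have h : ∀ t : ℝ, evalAt (X + t • vecMulVec ξ ξ) (genMinor φ ψ) =
        ((symPart X).submatrix φ ψ + t • vecMulVec (ξ ∘ φ) (ξ ∘ ψ)).det := fun t => by
      rw [evalAt_genMinor, symPart_add_smul_vecMulVec]
      rfl
    simpa only [h] using isPolyOfDegreeLE_det_add_smul_vecMulVec _ _ _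

theorem minorSpan_pow_le_rankOneKernel (r : ℕ) : minorSpan n ^ r ≤ rankOneKernel n r := by
  induction r with
  | zero =>
    rw [Submodule.pow_zero, Submodule.one_le]
    exact ⟨fun X => by simp, fun X ξ => by simpa using IsPolyOfDegreeLE.const 1⟩
  | succ r ih =>
    have h : minorSpan n ≤ rankOneKernel n 1 := by
      rw [minorSpan, Submodule.span_le]
      rintro _ ⟨P, rfl⟩
      exact genMinor_mem_rankOneKernel _ _
    rw [Submodule.pow_succ, Submodule.mul_le]
    exact fun p hp q hq => mul_mem_rankOneKernel (ih hp) (h hq)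

theorem congrAct_mem_rankOneKernel {r : ℕ} (g : Matrix (Fin n) (Fin n) ℝ)
    {p : MvPolynomial (Fin n × Fin n) ℝ} (hp : p ∈ rankOneKernel n r) :
    congrAct g p ∈ rankOneKernel n r := by
  refine ⟨fun X => ?_, fun X ξ => ?_⟩
  · rw [evalAt_congrAct, evalAt_congrAct, ← symPart_congr, hp.1]
  · have h : ∀ t : ℝ, evalAt (X + t • vecMulVec ξ ξ) (congrAct g p) =
        evalAt (gᵀ * X * g + t • vecMulVec (gᵀ *ᵥ ξ) (gᵀ *ᵥ ξ)) p := fun t => by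
      rw [evalAt_congrAct, Matrix.mul_add, Matrix.add_mul, Matrix.mul_smul, Matrix.smul_mul,
        mul_vecMulVec, vecMulVec_mul, mulVec_transpose]
    simpa only [h] using hp.2 _ _

/-- Polynomials in the entries of a matrix of degree at most `d` along every line through the
origin. -/
def degreeLE (n d : ℕ) : Submodule ℝ (MvPolynomial (Fin n × Fin n) ℝ) where
  carrier := {p | ∀ X, IsPolyOfDegreeLE d fun t => evalAt (t • X) p}
  zero_mem' X := by simpa using IsPolyOfDegreeLE.const 0
  add_mem' {p q} hp hq X := by simpa only [map_add] using (hp X).add (hq X)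
  smul_mem' c p hp X := by simpa only [map_smul, smul_eq_mul] using (hp X).const_mul c

theorem congrAct_mem_degreeLE {d : ℕ} (g : Matrix (Fin n) (Fin n) ℝ)
    {p : MvPolynomial (Fin n × Fin n) ℝ} (hp : p ∈ degreeLE n d) :
    congrAct g p ∈ degreeLE n d := fun X => by
  have h : ∀ t : ℝ, evalAt (t • X) (congrAct g p) = evalAt (t • (gᵀ * X * g)) p := fun t => by
    rw [evalAt_congrAct, Matrix.mul_smul, Matrix.smul_mul]
  simpa only [h] using hp _

theorem eval_aeval_polynomial (p : MvPolynomial (Fin n × Fin n) ℝ)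
    (M : Matrix (Fin n) (Fin n) (Polynomial ℝ)) (s : ℝ) :
    (aeval (fun ij : Fin n × Fin n => M ij.1 ij.2) p).eval s =
      evalAt (M.map (Polynomial.evalRingHom s)) p := by
  induction p using MvPolynomial.induction_on with
  | C a => simp [evalAt]
  | add p q hp hq => rw [map_add, map_add, Polynomial.eval_add, hp, hq]
  | mul_X p k hp => rw [map_mul, map_mul, Polynomial.eval_mul, hp]; simp [evalAt]

theorem exists_mem_degreeLE (p : MvPolynomial (Fin n × Fin n) ℝ) : ∃ d, p ∈ degreeLE n d := by
  refine ⟨p.totalDegree, fun X => ?_⟩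
  let M : Matrix (Fin n) (Fin n) (Polynomial ℝ) :=
    Matrix.of fun i j => Polynomial.C (X i j) * Polynomial.X
  refine ⟨aeval (fun ij : Fin n × Fin n => M ij.1 ij.2) p, ?_, fun t => ?_⟩
  · have := MvPolynomial.aeval_natDegree_le (n := 1) p le_rfl
      (fun ij : Fin n × Fin n => M ij.1 ij.2) fun _ => by
        simpa [M] using Polynomial.natDegree_C_mul_X_pow_le _ 1
    rwa [mul_one] at this
  · have hM : M.map (Polynomial.evalRingHom t) = t • X := by
      ext i j
      change (Polynomial.C (X i j) * Polynomial.X).eval t = t * X i j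
      rw [Polynomial.eval_C_mul, Polynomial.eval_X, mul_comm]
    rw [eval_aeval_polynomial, hM]

end RankOneKernel

section Weights

variable {n : ℕ}

/-- The torus weight of the entry `(i, j)` under `X ↦ diag(s) X diag(s)`. -/
noncomputable def entryWeight (ij : Fin n × Fin n) : Fin n →₀ ℕ :=
  Finsupp.single ij.1 1 + Finsupp.single ij.2 1

/-- A polynomial which is a weight vector of weight `w` for `X ↦ diag(s) X diag(s)`. -/
def HasWeight (p : MvPolynomial (Fin n × Fin n) ℝ) (w : Fin n →₀ ℕ) : Prop :=
  ∀ s : Fin n → ℝ, congrAct (diagonal s) p = (∏ i, s i ^ w i) • p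

theorem HasWeight.evalAt_eq {p : MvPolynomial (Fin n × Fin n) ℝ} {w : Fin n →₀ ℕ}
    (h : HasWeight p w) (s : Fin n → ℝ) (X : Matrix (Fin n) (Fin n) ℝ) :
    evalAt (diagonal s * X * diagonal s) p = (∏ i, s i ^ w i) * evalAt X p := by
  have := congrArg (evalAt X) (h s)
  rwa [evalAt_congrAct, diagonal_transpose, map_smul, smul_eq_mul] at this

theorem hasWeight_monomial_one (m : Fin n × Fin n →₀ ℕ) :
    HasWeight (monomial m 1) (Finsupp.weight entryWeight m) := by
  intro s
  induction m using Finsupp.induction_linear with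
  | zero => simp
  | add m m' h h' =>
    have hmul : monomial (m + m') (1 : ℝ) = monomial m 1 * monomial m' 1 := by
      rw [monomial_mul, one_mul]
    rw [hmul, map_mul, h, h', smul_mul_smul_comm, map_add, ← Finset.prod_mul_distrib]
    simp only [Finsupp.add_apply, pow_add]
  | single ij k =>
    have hX : congrAct (diagonal s) (X ij) = (s ij.1 * s ij.2) • X ij := by
      refine evalAt_ext fun Y => ?_
      rw [evalAt_congrAct, diagonal_transpose, map_smul]
      simp only [evalAt, aeval_X, mul_diagonal, diagonal_mul, smul_eq_mul]
      ring
    have hprod : ∏ i, s i ^ (Finsupp.weight entryWeight (Finsupp.single ij k)) i =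
        (s ij.1 * s ij.2) ^ k := by
      simp only [Finsupp.weight_single, entryWeight, Finsupp.smul_apply, Finsupp.add_apply,
        smul_eq_mul, mul_comm k, pow_mul, pow_add, Finset.prod_pow, Finset.prod_mul_distrib]
      congr 2 <;> simp [Finsupp.single_apply, pow_ite, Finset.prod_ite_eq]
    rw [← X_pow_eq_monomial, map_pow, hX, smul_pow, hprod]

theorem coeff_congrAct_diagonal (s : Fin n → ℝ) (p : MvPolynomial (Fin n × Fin n) ℝ)
    (m : Fin n × Fin n →₀ ℕ) : coeff m (congrAct (diagonal s) p) =
      (∏ i, s i ^ (Finsupp.weight entryWeight m) i) * coeff m p := by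
  classical
  induction p using MvPolynomial.induction_on' with
  | add p q hp hq => rw [map_add, coeff_add, hp, hq, coeff_add, mul_add]
  | monomial m' a =>
    have h : monomial m' a = a • monomial m' (1 : ℝ) := by simp [smul_monomial]
    rw [h, map_smul, hasWeight_monomial_one m' s, coeff_smul, coeff_smul, coeff_smul,
      coeff_monomial]
    split_ifs with hm
    · subst hm
      simp [mul_comm]
    · simp

/-- The component of weight `w` of a polynomial. -/
noncomputable def weightComponent (w : Fin n →₀ ℕ) :
    MvPolynomial (Fin n × Fin n) ℝ →ₗ[ℝ] MvPolynomial (Fin n × Fin n) ℝ :=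
  weightedHomogeneousComponent entryWeight w

theorem hasWeight_weightComponent (w : Fin n →₀ ℕ) (p : MvPolynomial (Fin n × Fin n) ℝ) :
    HasWeight (weightComponent w p) w := by
  classical
  intro s
  ext m
  rw [coeff_congrAct_diagonal, coeff_smul, smul_eq_mul, weightComponent,
    coeff_weightedHomogeneousComponent]
  split_ifs with h
  · rw [h]
  · simp

theorem congrAct_diagonal_eq_sum (s : Fin n → ℝ) (p : MvPolynomial (Fin n × Fin n) ℝ) :
    congrAct (diagonal s) p = ∑ w ∈ p.support.image (Finsupp.weight entryWeight),
      (∏ i, s i ^ w i) • weightComponent w p := by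
  classical
  ext m
  rw [coeff_congrAct_diagonal, coeff_sum]
  simp only [coeff_smul, smul_eq_mul, weightComponent, coeff_weightedHomogeneousComponent,
    mul_ite, mul_zero, Finset.sum_ite_eq]
  split_ifs with h
  · rfl
  · have : coeff m p = 0 := by
      by_contra hm
      exact h (Finset.mem_image_of_mem _ (mem_support_iff.2 hm))
    rw [this, mul_zero]

theorem eq_sum_weightComponent (p : MvPolynomial (Fin n × Fin n) ℝ) :
    p = ∑ w ∈ p.support.image (Finsupp.weight entryWeight), weightComponent w p := by
  have h := congrAct_diagonal_eq_sum (fun _ => 1) p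
  have h₁ : congrAct (diagonal fun _ => 1) p = p :=
    evalAt_ext fun X => by simp [evalAt_congrAct]
  rw [h₁] at h
  simpa using h

theorem weightComponent_mem {W : Submodule ℝ (MvPolynomial (Fin n × Fin n) ℝ)}
    (hW : ∀ s : Fin n → ℝ, ∀ p ∈ W, congrAct (diagonal s) p ∈ W)
    {p : MvPolynomial (Fin n × Fin n) ℝ} (hp : p ∈ W) (w : Fin n →₀ ℕ) :
    weightComponent w p ∈ W := by
  classical
  by_contra hw
  obtain ⟨L, hL, hLW⟩ := Submodule.exists_le_ker_of_notMem hw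
  let T := p.support.image (Finsupp.weight entryWeight)
  have hpoly : ∑ w' ∈ T, monomial w' (L (weightComponent w' p)) = 0 := by
    refine MvPolynomial.funext fun s => ?_
    have h : L (congrAct (diagonal s) p) = 0 := hLW (hW s p hp)
    rw [congrAct_diagonal_eq_sum, map_sum] at h
    rw [map_sum, map_zero, ← h]
    refine Finset.sum_congr rfl fun w' _ => ?_
    rw [eval_monomial, map_smul, smul_eq_mul, mul_comm,
      Finsupp.prod_fintype _ _ fun _ => pow_zero _]
  have hc := congrArg (coeff w) hpoly
  simp only [coeff_sum, coeff_monomial, Finset.sum_ite_eq', coeff_zero] at hc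
  split_ifs at hc with hT
  · exact hL hc
  · refine hL ?_
    have : weightComponent w p = 0 := by
      ext m
      rw [weightComponent, coeff_weightedHomogeneousComponent, coeff_zero]
      split_ifs with hm
      · by_contra hne
        exact hT (hm ▸ Finset.mem_image_of_mem _ (mem_support_iff.2 hne))
      · rfl
    rw [this, map_zero]

theorem exists_evalAt_ne_zero {p : MvPolynomial (Fin n × Fin n) ℝ} (hp : p ≠ 0) :
    ∃ X, evalAt X p ≠ 0 := by
  by_contra! h
  exact hp (evalAt_ext fun X => by rw [h, map_zero])

theorem HasWeight.sum_le {d : ℕ} {p : MvPolynomial (Fin n × Fin n) ℝ} {w : Fin n →₀ ℕ}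
    (h : HasWeight p w) (hp : p ≠ 0) (hd : p ∈ degreeLE n d) : ∑ i, w i ≤ 2 * d := by
  obtain ⟨X, hX⟩ := exists_evalAt_ne_zero hp
  obtain ⟨q, hq, hqX⟩ := hd X
  beta_reduce at hqX
  have hpoly : q.comp (Polynomial.X ^ 2) =
      Polynomial.C (evalAt X p) * Polynomial.X ^ (∑ i, w i) := by
    refine Polynomial.funext fun t => ?_
    have h₁ := h.evalAt_eq (fun _ => t) X
    have h₂ : diagonal (fun _ => t) * X * diagonal (fun _ => t) = t ^ 2 • X := by
      ext i j
      simp only [mul_diagonal, diagonal_mul, Matrix.smul_apply, smul_eq_mul]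
      ring
    rw [h₂, hqX, Finset.prod_pow_eq_pow_sum] at h₁
    rw [Polynomial.eval_comp, Polynomial.eval_pow, Polynomial.eval_X, Polynomial.eval_mul,
      Polynomial.eval_C, Polynomial.eval_pow, Polynomial.eval_X, h₁, mul_comm]
  have hdeg := congrArg Polynomial.natDegree hpoly
  rw [Polynomial.natDegree_comp, Polynomial.natDegree_X_pow,
    Polynomial.natDegree_C_mul_X_pow _ _ hX] at hdeg
  omega

/-- The height of a weight; it strictly increases when weight is moved to a smaller index. -/
def height (w : Fin n →₀ ℕ) : ℕ := ∑ i, (i.rev : ℕ) * w i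

theorem height_le (w : Fin n →₀ ℕ) : height w ≤ n * ∑ i, w i := by
  rw [height, Finset.mul_sum]
  exact Finset.sum_le_sum fun i _ => Nat.mul_le_mul_right _ i.rev.is_lt.le

/-- A nonzero weight vector whose weight has maximal height in `W`. -/
structure IsHighest (W : Submodule ℝ (MvPolynomial (Fin n × Fin n) ℝ))
    (p : MvPolynomial (Fin n × Fin n) ℝ) (w : Fin n →₀ ℕ) : Prop where
  mem : p ∈ W
  ne_zero : p ≠ 0
  hasWeight : HasWeight p w
  height_le : ∀ p' ∈ W, p' ≠ 0 → ∀ w', HasWeight p' w' → height w' ≤ height w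

theorem exists_isHighest {d : ℕ} {W : Submodule ℝ (MvPolynomial (Fin n × Fin n) ℝ)}
    (hW : ∀ g, ∀ p ∈ W, congrAct g p ∈ W) (hd : W ≤ degreeLE n d) (hne : W ≠ ⊥) :
    ∃ p w, IsHighest W p w := by
  let S : Set ℕ := {k | ∃ p ∈ W, p ≠ 0 ∧ ∃ w, HasWeight p w ∧ height w = k}
  have hS : S.Nonempty := by
    obtain ⟨p, hp, hp0⟩ := Submodule.exists_mem_ne_zero_of_ne_bot hne
    have : ∃ w, weightComponent w p ≠ 0 := by
      by_contra! h
      rw [eq_sum_weightComponent p] at hp0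
      exact hp0 (Finset.sum_eq_zero fun w _ => h w)
    obtain ⟨w, hw⟩ := this
    exact ⟨_, _, weightComponent_mem (fun s => hW _) hp w, hw, w, hasWeight_weightComponent w p, rfl⟩
  have hbdd : BddAbove S := by
    refine ⟨n * (2 * d), ?_⟩
    rintro _ ⟨p, hp, hp0, w, hw, rfl⟩
    exact (RankOneMinors.height_le w).trans (Nat.mul_le_mul_left _ (hw.sum_le hp0 (hd hp)))
  obtain ⟨p, hp, hp0, w, hw, hk⟩ := Nat.sSup_mem hS hbdd
  exact ⟨p, w, hp, hp0, hw, fun p' hp' hp0' w' hw' =>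
    hk ▸ le_csSup hbdd ⟨p', hp', hp0', w', hw', rfl⟩⟩

end Weights

section Highest

variable {n : ℕ} {W : Submodule ℝ (MvPolynomial (Fin n × Fin n) ℝ)}
  {p : MvPolynomial (Fin n × Fin n) ℝ} {w : Fin n →₀ ℕ}

/-- Upper triangular congruences act on highest weight vectors through their diagonal. -/
theorem IsHighest.evalAt_congr_of_isUpperTriangular (hW : ∀ g, ∀ p ∈ W, congrAct g p ∈ W)
    (h : IsHighest W p w) {b : Matrix (Fin n) (Fin n) ℝ} (hb : b.IsUpperTriangular)
    (X : Matrix (Fin n) (Fin n) ℝ) :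
    evalAt (bᵀ * X * b) p = evalAt (diagonal b.diag * X * diagonal b.diag) p := by
  classical
  let bs : ℝ → Matrix (Fin n) (Fin n) ℝ := fun s =>
    Matrix.of fun i j => b i j * s ^ ((i.rev : ℕ) - j.rev)
  let B : Matrix (Fin n) (Fin n) (Polynomial ℝ) :=
    Matrix.of fun i j => Polynomial.C (b i j) * Polynomial.X ^ ((i.rev : ℕ) - j.rev)
  let Q : Polynomial ℝ :=
    aeval (fun ij : Fin n × Fin n => (Bᵀ * X.map Polynomial.C * B) ij.1 ij.2) p
  have hQ : ∀ s, Q.eval s = evalAt ((bs s)ᵀ * X * bs s) p := fun s => by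
    have hB : B.map (Polynomial.evalRingHom s) = bs s := by
      ext i j
      simp [B, bs]
    have hX : (X.map Polynomial.C).map (Polynomial.evalRingHom s) = X := by
      ext i j
      simp
    rw [eval_aeval_polynomial, Matrix.map_mul, Matrix.map_mul, transpose_map, hB, hX]
  let g := congrAct b p
  let R : Polynomial ℝ := ∑ w' ∈ g.support.image (Finsupp.weight entryWeight),
    Polynomial.monomial (height w') (evalAt X (weightComponent w' g))
  have hR : R.natDegree ≤ height w := by
    refine Polynomial.natDegree_sum_le_of_forall_le _ _ fun w' _ => ?_
    by_cases h0 : weightComponent w' g = 0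
    · simp [h0]
    · exact (Polynomial.natDegree_monomial_le _).trans <|
        h.height_le _ (weightComponent_mem (fun s => hW _) (hW b p h.mem) w') h0 _
          (hasWeight_weightComponent w' g)
  have hprod : ∀ (s : ℝ) (w' : Fin n →₀ ℕ), ∏ i, (s ^ (i.rev : ℕ)) ^ w' i = s ^ height w' :=
    fun s w' => by simp only [height, ← pow_mul, Finset.prod_pow_eq_pow_sum]
  have hQR : Polynomial.X ^ height w * Q = R := by
    refine Polynomial.funext fun s => ?_
    let D : Matrix (Fin n) (Fin n) ℝ := diagonal fun i => s ^ (i.rev : ℕ)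
    have hD : bs s * D = D * b := by
      ext i j
      simp only [D, mul_diagonal, diagonal_mul, bs, Matrix.of_apply]
      rcases lt_or_ge j i with hij | hij
      · simp [hb hij]
      · have hle : (j.rev : ℕ) ≤ i.rev := Fin.rev_le_rev.2 hij
        rw [mul_assoc, ← pow_add, Nat.sub_add_cancel hle, mul_comm]
    have hD' : D * (bs s)ᵀ = bᵀ * D := by
      have := congrArg transpose hD
      rwa [transpose_mul, transpose_mul, diagonal_transpose] at this
    have h₁ := h.hasWeight.evalAt_eq (fun i => s ^ (i.rev : ℕ)) ((bs s)ᵀ * X * bs s)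
    have h₂ : D * ((bs s)ᵀ * X * bs s) * D = bᵀ * (D * X * D) * b :=
      calc D * ((bs s)ᵀ * X * bs s) * D = D * (bs s)ᵀ * X * (bs s * D) := by
            simp only [Matrix.mul_assoc]
        _ = bᵀ * (D * X * D) * b := by rw [hD, hD']; simp only [Matrix.mul_assoc]
    have h₃ := congrArg (evalAt X) (congrAct_diagonal_eq_sum (fun i => s ^ (i.rev : ℕ)) g)
    rw [evalAt_congrAct, diagonal_transpose, evalAt_congrAct, ← h₂, h₁, map_sum, hprod,
      ← hQ] at h₃
    rw [Polynomial.eval_mul, Polynomial.eval_pow, Polynomial.eval_X, h₃, Polynomial.eval_finsetSum]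
    refine Finset.sum_congr rfl fun w' _ => ?_
    rw [map_smul, hprod, Polynomial.eval_monomial, smul_eq_mul, mul_comm]
  have hconst : Q.natDegree = 0 := by
    by_cases hQ0 : Q = 0
    · simp [hQ0]
    · rw [← hQR, Polynomial.natDegree_X_pow_mul _ hQ0] at hR
      omega
  have hev : Q.eval 1 = Q.eval 0 := by
    rw [Polynomial.eq_C_of_natDegree_eq_zero hconst]
    simp
  have hbs1 : bs 1 = b := by
    ext i j
    simp [bs]
  have hbs0 : bs 0 = diagonal b.diag := by
    ext i j
    simp only [bs, Matrix.of_apply]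
    rcases lt_trichotomy i j with hij | rfl | hij
    · have hlt : (j.rev : ℕ) < i.rev := Fin.rev_lt_rev.2 hij
      rw [zero_pow (Nat.sub_ne_zero_of_lt hlt), mul_zero, diagonal_apply_ne _ hij.ne]
    · simp
    · simp [hb hij, hij.ne']
  rwa [hQ, hQ, hbs1, hbs0, diagonal_transpose] at hev

theorem IsHighest.evalAt_transpose_mul_self (hW : ∀ g, ∀ p ∈ W, congrAct g p ∈ W)
    (h : IsHighest W p w) {b : Matrix (Fin n) (Fin n) ℝ} (hb : b.IsUpperTriangular) :
    evalAt (bᵀ * b) p = (∏ i, b i i ^ w i) * evalAt 1 p := by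
  have h₁ := h.evalAt_congr_of_isUpperTriangular hW hb 1
  rwa [h.hasWeight.evalAt_eq, Matrix.mul_one] at h₁

theorem IsHighest.antitone (hW : ∀ g, ∀ p ∈ W, congrAct g p ∈ W) (h : IsHighest W p w) :
    Antitone w := by
  intro i j hij
  by_contra! hlt
  have hne : i ≠ j := by
    rintro rfl
    exact lt_irrefl _ hlt
  let e := Equiv.swap i j
  let P : Matrix (Fin n) (Fin n) ℝ := (1 : Matrix (Fin n) (Fin n) ℝ).submatrix e id
  have hP : ∀ X, Pᵀ * X * P = X.submatrix e e := fun X => by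
    have hPt : Pᵀ = (1 : Matrix (Fin n) (Fin n) ℝ).submatrix id e := by
      rw [transpose_submatrix, transpose_one]
    rw [hPt, one_submatrix_mul, mul_submatrix_one]
    simp only [e, Equiv.symm_swap, Function.comp_id, submatrix_submatrix]
    rfl
  let w' : Fin n →₀ ℕ := Finsupp.equivFunOnFinite.symm fun k => w (e k)
  have hw' : ∀ k, w' k = w (e k) := fun k => rfl
  have hwt : HasWeight (congrAct P p) w' := by
    intro s
    refine evalAt_ext fun X => ?_
    have hX : (diagonal s * X * diagonal s).submatrix e e =
        diagonal (s ∘ e) * X.submatrix e e * diagonal (s ∘ e) := by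
      ext k l
      simp
    rw [map_smul, evalAt_congrAct, evalAt_congrAct, evalAt_congrAct, diagonal_transpose, hP, hP,
      hX, h.hasWeight.evalAt_eq, smul_eq_mul]
    congr 1
    rw [← Equiv.prod_comp e]
    simp [hw', e]
  have hne0 : congrAct P p ≠ 0 := by
    intro h0
    obtain ⟨X, hX⟩ := exists_evalAt_ne_zero h.ne_zero
    have h₁ := congrArg (evalAt (X.submatrix e e)) h0
    rw [evalAt_congrAct, hP, map_zero] at h₁
    apply hX
    rw [← h₁]
    congr 2
    ext k l
    simp [e]
  have hle := h.height_le _ (hW P p h.mem) hne0 w' hwt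
  have hsplit : ∀ v : Fin n →₀ ℕ, height v = (i.rev : ℕ) * v i + ((j.rev : ℕ) * v j +
      ∑ k ∈ (Finset.univ.erase i).erase j, (k.rev : ℕ) * v k) := fun v => by
    rw [height, ← Finset.add_sum_erase _ _ (Finset.mem_univ i), ← Finset.add_sum_erase _ _
      (Finset.mem_erase.2 ⟨hne.symm, Finset.mem_univ j⟩)]
  have hrest : ∑ k ∈ (Finset.univ.erase i).erase j, (k.rev : ℕ) * w' k =
      ∑ k ∈ (Finset.univ.erase i).erase j, (k.rev : ℕ) * w k := by
    refine Finset.sum_congr rfl fun k hk => ?_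
    simp only [Finset.mem_erase] at hk
    rw [hw', Equiv.swap_apply_of_ne_of_ne hk.2.1 hk.1]
  have hrev : (j.rev : ℕ) < i.rev := Fin.rev_lt_rev.2 (lt_of_le_of_ne hij hne)
  rw [hsplit w, hsplit w', hrest, hw', hw', Equiv.swap_apply_left, Equiv.swap_apply_right] at hle
  nlinarith

theorem HasWeight.even_of_evalAt_one_ne_zero (h : HasWeight p w) (h1 : evalAt 1 p ≠ 0)
    (i : Fin n) : Even (w i) := by
  have h₁ := h.evalAt_eq (Function.update 1 i (-1)) 1
  have h₂ : diagonal (Function.update 1 i (-1)) * (1 : Matrix (Fin n) (Fin n) ℝ) *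
      diagonal (Function.update 1 i (-1)) = 1 := by
    rw [Matrix.mul_one, diagonal_mul_diagonal, ← diagonal_one]
    congr 1
    ext k
    rcases eq_or_ne k i with rfl | hk
    · simp
    · simp [hk]
  rw [h₂, Finset.prod_eq_single i (fun k _ hk => by simp [hk]) (by simp), Function.update_self,
    eq_comm, mul_eq_right₀ h1] at h₁
  rcases Nat.even_or_odd (w i) with hw | hw
  · exact hw
  · rw [hw.neg_one_pow] at h₁
    norm_num at h₁

theorem HasWeight.le_of_mem_rankOneKernel {r : ℕ} (h : HasWeight p w) (h1 : evalAt 1 p ≠ 0)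
    (hp : p ∈ rankOneKernel n r) (i : Fin n) : w i ≤ 2 * r := by
  obtain ⟨q, hq, hqt⟩ := hp.2 1 (Pi.single i 1)
  beta_reduce at hqt
  have hpoly : q.comp (Polynomial.X ^ 2 - 1) =
      Polynomial.C (evalAt 1 p) * Polynomial.X ^ w i := by
    refine Polynomial.funext fun t => ?_
    have h₁ := h.evalAt_eq (Function.update 1 i t) 1
    have h₂ : diagonal (Function.update 1 i t) * (1 : Matrix (Fin n) (Fin n) ℝ) *
        diagonal (Function.update 1 i t) =
        1 + (t ^ 2 - 1) • vecMulVec (Pi.single i 1) (Pi.single i 1) := by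
      rw [Matrix.mul_one, diagonal_mul_diagonal]
      ext k l
      rcases eq_or_ne k l with rfl | hkl
      · rcases eq_or_ne k i with rfl | hk
        · simp [vecMulVec_apply]
          ring
        · simp [vecMulVec_apply, hk]
      · have : (Pi.single i (1 : ℝ) : Fin n → ℝ) k * (Pi.single i 1 : Fin n → ℝ) l = 0 := by
          rcases eq_or_ne k i with rfl | hk
          · simp [hkl.symm]
          · simp [hk]
        simp [vecMulVec_apply, hkl, this]
    rw [h₂, hqt, Finset.prod_eq_single i (fun k _ hk => by simp [hk]) (by simp),
      Function.update_self] at h₁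
    rw [Polynomial.eval_comp, Polynomial.eval_sub, Polynomial.eval_pow, Polynomial.eval_X,
      Polynomial.eval_one, Polynomial.eval_mul, Polynomial.eval_C, Polynomial.eval_pow,
      Polynomial.eval_X, h₁, mul_comm]
  have hdeg := congrArg Polynomial.natDegree hpoly
  have h2 : (Polynomial.X ^ 2 - 1 : Polynomial ℝ).natDegree = 2 := by
    simpa using Polynomial.natDegree_X_pow_sub_C (R := ℝ) (n := 2) (r := 1)
  rw [Polynomial.natDegree_comp, h2, Polynomial.natDegree_C_mul_X_pow _ _ h1] at hdeg
  omega

end Highest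

section Cholesky

variable {n : ℕ}

theorem exists_isUpperTriangular_transpose_mul_self {A : Matrix (Fin n) (Fin n) ℝ}
    (hA : A.PosDef) : ∃ b : Matrix (Fin n) (Fin n) ℝ, b.IsUpperTriangular ∧ bᵀ * b = A := by
  have hL : (LDL.lower hA).IsLowerTriangular :=
    blockTriangular_inv_of_blockTriangular fun i j hij => LDL.lowerInv_triangular hA hij
  have hD : ∀ i, 0 ≤ LDL.diagEntries hA i := by
    rw [← posSemidef_diagonal_iff, ← LDL.diag, LDL.diag_eq_lowerInv_conj]
    exact hA.posSemidef.mul_mul_conjTranspose_same _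
  refine ⟨diagonal (fun i => √(LDL.diagEntries hA i)) * (LDL.lower hA)ᵀ, fun i j hij => ?_, ?_⟩
  · rw [diagonal_mul, transpose_apply, hL hij, mul_zero]
  · conv_rhs => rw [← LDL.lower_conj_diag hA]
    have hsq : diagonal (fun i => √(LDL.diagEntries hA i)) *
        diagonal (fun i => √(LDL.diagEntries hA i)) = LDL.diag hA := by
      rw [diagonal_mul_diagonal, LDL.diag]
      exact congrArg diagonal (funext fun i => Real.mul_self_sqrt (hD i))
    rw [transpose_mul, transpose_transpose, diagonal_transpose, Matrix.mul_assoc,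
      ← Matrix.mul_assoc (diagonal _), hsq, ← Matrix.mul_assoc, conjTranspose_eq_transpose_of_trivial]

theorem posDef_add_smul_one {A : Matrix (Fin n) (Fin n) ℝ} (hA : A.IsSymm) {t : ℝ}
    (ht : ∑ i, ∑ j, |A i j| < t) : (A + t • (1 : Matrix (Fin n) (Fin n) ℝ)).PosDef := by
  refine PosDef.of_dotProduct_mulVec_pos ?_ fun x hx => ?_
  · rw [IsHermitian, conjTranspose_eq_transpose_of_trivial]
    exact hA.add (isSymm_one.smul t)
  · have hx0 : 0 < x ⬝ᵥ x := by
      simpa using dotProduct_star_self_pos_iff.2 hx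
    have hle : ∀ i j, -(|A i j| * (x ⬝ᵥ x)) ≤ x i * (A i j * x j) := fun i j => by
      have hsq : ∀ k, x k * x k ≤ x ⬝ᵥ x := fun k =>
        Finset.single_le_sum (f := fun k => x k * x k) (fun k _ => mul_self_nonneg _)
          (Finset.mem_univ k)
      have h₁ : |x i * x j| ≤ x ⬝ᵥ x := by
        rw [abs_le]
        constructor <;> nlinarith [hsq i, hsq j, sq_nonneg (x i + x j), sq_nonneg (x i - x j)]
      have h₂ : |x i * (A i j * x j)| ≤ |A i j| * (x ⬝ᵥ x) := by
        rw [mul_left_comm, abs_mul]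
        exact mul_le_mul_of_nonneg_left h₁ (abs_nonneg _)
      exact neg_le_of_abs_le h₂
    have hsum : -((∑ i, ∑ j, |A i j|) * (x ⬝ᵥ x)) ≤ x ⬝ᵥ (A *ᵥ x) := by
      generalize x ⬝ᵥ x = a at hle
      simp only [dotProduct, mulVec, Finset.mul_sum, Finset.sum_mul, ← Finset.sum_neg_distrib]
      exact Finset.sum_le_sum fun i _ => Finset.sum_le_sum fun j _ => hle i j
    rw [star_trivial, add_mulVec, smul_mulVec, one_mulVec, dotProduct_add, dotProduct_smul,
      smul_eq_mul]
    nlinarith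

/-- The matrices `bᵀ b` with `b` upper triangular are Zariski dense in the symmetric matrices. -/
theorem eq_zero_of_evalAt_transpose_mul_self {p : MvPolynomial (Fin n × Fin n) ℝ}
    (hp : ∀ X, evalAt (symPart X) p = evalAt X p)
    (h : ∀ b : Matrix (Fin n) (Fin n) ℝ, b.IsUpperTriangular → evalAt (bᵀ * b) p = 0) : p = 0 := by
  refine evalAt_ext fun X => ?_
  rw [← hp, map_zero]
  let M : Matrix (Fin n) (Fin n) (Polynomial ℝ) :=
    (symPart X).map Polynomial.C + (Polynomial.X : Polynomial ℝ) • 1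
  have hM : ∀ t, M.map (Polynomial.evalRingHom t) =
      symPart X + t • (1 : Matrix (Fin n) (Fin n) ℝ) := fun t => by
    ext i j
    rcases eq_or_ne i j with rfl | hij
    · simp [M]
    · simp [M, hij]
  have hzero : aeval (fun ij : Fin n × Fin n => M ij.1 ij.2) p = (0 : Polynomial ℝ) := by
    refine Polynomial.eq_zero_of_infinite_isRoot _ ?_
    refine (Set.Ioi_infinite (∑ i, ∑ j, |symPart X i j|)).mono fun t ht => ?_
    obtain ⟨b, hb, hbA⟩ :=
      exists_isUpperTriangular_transpose_mul_self (posDef_add_smul_one (isSymm_symPart X) ht)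
    rw [Set.mem_ofPred_eq, Polynomial.IsRoot.def, eval_aeval_polynomial, hM, ← hbA, h b hb]
  have h0 := eval_aeval_polynomial p M 0
  rwa [hzero, hM, Polynomial.eval_zero, zero_smul, add_zero, eq_comm] at h0

end Cholesky

section Main

variable {n : ℕ}

/-- A leading principal minor of `bᵀ b` for upper triangular `b`. -/
theorem evalAt_genMinor_transpose_mul_self {b : Matrix (Fin n) (Fin n) ℝ}
    (hb : b.IsUpperTriangular) {I : Finset (Fin n)} (hI : IsLowerSet (I : Set (Fin n))) :
    evalAt (bᵀ * b) (genMinor (I.orderEmbOfFin rfl) (I.orderEmbOfFin rfl)) =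
      ∏ i ∈ I, b i i ^ 2 := by
  let φ := I.orderEmbOfFin rfl
  have hsymm : (bᵀ * b).IsSymm := by
    rw [Matrix.IsSymm, transpose_mul, transpose_transpose]
  have hsum : ∀ F : Fin n → ℝ, ∑ k, F (φ k) = ∑ i ∈ I, F i := fun F => by
    conv_rhs => rw [← Finset.map_orderEmbOfFin_univ I rfl, Finset.sum_map]
    rfl
  have hprod : ∀ F : Fin n → ℝ, ∏ k, F (φ k) = ∏ i ∈ I, F i := fun F => by
    conv_rhs => rw [← Finset.map_orderEmbOfFin_univ I rfl, Finset.prod_map]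
    rfl
  have hmul : (bᵀ * b).submatrix φ φ = (b.submatrix φ φ)ᵀ * b.submatrix φ φ := by
    ext k l
    simp only [submatrix_apply, Matrix.mul_apply, transpose_apply]
    rw [hsum fun i => b i (φ k) * b i (φ l)]
    refine (Finset.sum_subset (Finset.subset_univ I) fun i _ hi => ?_).symm
    have hlt : φ k < i := by
      by_contra! hle
      exact hi (hI hle (I.orderEmbOfFin_mem rfl k))
    rw [hb hlt, zero_mul]
  have hdet : (b.submatrix φ φ).det = ∏ i ∈ I, b i i := by
    have htri : (b.submatrix φ φ).IsUpperTriangular := fun k l hkl => hb (φ.lt_iff_lt.2 hkl)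
    rw [det_of_isUpperTriangular htri, ← hprod]
    rfl
  rw [evalAt_genMinor, symPart_of_isSymm hsymm, hmul, det_mul, det_transpose, hdet,
    ← Finset.prod_mul_distrib]
  exact Finset.prod_congr rfl fun i _ => (sq _).symm

theorem prod_range_mem_pow {M : Submodule ℝ (MvPolynomial (Fin n × Fin n) ℝ)}
    {F : ℕ → MvPolynomial (Fin n × Fin n) ℝ} (hF : ∀ j, F j ∈ M) (r : ℕ) :
    ∏ j ∈ Finset.range r, F j ∈ M ^ r := by
  induction r with
  | zero => simp [Submodule.one_le.1 le_rfl]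
  | succ r ih =>
    rw [Finset.prod_range_succ, Submodule.pow_succ]
    exact Submodule.mul_mem_mul ih (hF r)

theorem exists_mem_minorSpan_pow {r : ℕ} {v : Fin n → ℕ} (hv : Antitone v) (hr : ∀ i, v i ≤ r) :
    ∃ q ∈ minorSpan n ^ r, ∀ b : Matrix (Fin n) (Fin n) ℝ, b.IsUpperTriangular →
      evalAt (bᵀ * b) q = ∏ i, b i i ^ (2 * v i) := by
  let I : ℕ → Finset (Fin n) := fun j => Finset.univ.filter fun i => j < v i
  have hI : ∀ j, IsLowerSet (I j : Set (Fin n)) := fun j i k hki hi => by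
    simp only [I, Finset.coe_filter, Finset.mem_univ, true_and, Set.mem_ofPred_eq] at hi ⊢
    exact hi.trans_le (hv hki)
  refine ⟨∏ j ∈ Finset.range r, genMinor ((I j).orderEmbOfFin rfl) ((I j).orderEmbOfFin rfl),
    ?_, fun b hb => ?_⟩
  · exact prod_range_mem_pow (fun j => genMinor_mem _ _) r
  · rw [map_prod, Finset.prod_congr rfl fun j _ => evalAt_genMinor_transpose_mul_self hb (hI j)]
    simp only [I, Finset.prod_filter]
    rw [Finset.prod_comm]
    refine Finset.prod_congr rfl fun i _ => ?_
    rw [← Finset.prod_filter, Finset.prod_const, ← pow_mul]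
    congr 2
    have : (Finset.range r).filter (fun j => j < v i) = Finset.range (v i) := by
      ext j
      simp only [Finset.mem_filter, Finset.mem_range]
      have := hr i
      omega
    rw [this, Finset.card_range]

/-- The elements of `rankOneKernel n r ⊓ degreeLE n d` which are orthogonal to the `r`-fold
products of minors for the Fischer form. -/
noncomputable def orthogonalKernel (n r d : ℕ) : Submodule ℝ (MvPolynomial (Fin n × Fin n) ℝ) where
  carrier := {p | p ∈ rankOneKernel n r ∧ p ∈ degreeLE n d ∧ ∀ m ∈ minorSpan n ^ r, fischer m p = 0}
  zero_mem' := ⟨zero_mem _, zero_mem _, fun m _ => by simp⟩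
  add_mem' {p q} hp hq := ⟨add_mem hp.1 hq.1, add_mem hp.2.1 hq.2.1, fun m hm => by
    rw [map_add, hp.2.2 m hm, hq.2.2 m hm, add_zero]⟩
  smul_mem' c p hp := ⟨Submodule.smul_mem _ c hp.1, Submodule.smul_mem _ c hp.2.1, fun m hm => by
    rw [map_smul, hp.2.2 m hm, smul_zero]⟩

theorem congrAct_mem_orthogonalKernel {r d : ℕ} (g : Matrix (Fin n) (Fin n) ℝ)
    (p : MvPolynomial (Fin n × Fin n) ℝ) (hp : p ∈ orthogonalKernel n r d) :
    congrAct g p ∈ orthogonalKernel n r d :=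
  ⟨congrAct_mem_rankOneKernel g hp.1, congrAct_mem_degreeLE g hp.2.1, fun m hm => by
    rw [fischer_congrAct]
    exact hp.2.2 _ (congrAct_mem_minorSpan_pow gᵀ r hm)⟩

theorem orthogonalKernel_eq_bot (n r d : ℕ) : orthogonalKernel n r d = ⊥ := by
  by_contra hne
  have hW := fun g p => congrAct_mem_orthogonalKernel (n := n) (r := r) (d := d) g p
  obtain ⟨p, w, hp⟩ := exists_isHighest hW (fun p hp => hp.2.1) hne
  have hsymm := hp.mem.1.1
  have h1 : evalAt 1 p ≠ 0 := fun h1 => hp.ne_zero <|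
    eq_zero_of_evalAt_transpose_mul_self hsymm fun b hb => by
      rw [hp.evalAt_transpose_mul_self hW hb, h1, mul_zero]
  have heven := fun i => (hp.hasWeight.even_of_evalAt_one_ne_zero h1 i).two_dvd
  choose v hv using heven
  have hanti : Antitone v := fun i j hij => by
    have := hp.antitone hW hij
    rw [hv, hv] at this
    omega
  have hle : ∀ i, v i ≤ r := fun i => by
    have := hp.hasWeight.le_of_mem_rankOneKernel h1 hp.mem.1 i
    rw [hv] at this
    omega
  obtain ⟨q, hq, hqb⟩ := exists_mem_minorSpan_pow hanti hle
  have hpq : p - evalAt 1 p • q = 0 := by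
    refine eq_zero_of_evalAt_transpose_mul_self (fun X => ?_) fun b hb => ?_
    · rw [map_sub, map_sub, map_smul, map_smul, hsymm,
        (minorSpan_pow_le_rankOneKernel r hq).1]
    · rw [map_sub, map_smul, hp.evalAt_transpose_mul_self hW hb, hqb b hb, smul_eq_mul, mul_comm,
        sub_eq_zero]
      simp only [hv]
  refine hp.ne_zero (fischer_self_eq_zero ?_)
  exact hp.mem.2.2 p (sub_eq_zero.1 hpq ▸ Submodule.smul_mem _ _ hq)

theorem rankOneKernel_eq_minorSpan_pow (n r : ℕ) : rankOneKernel n r = minorSpan n ^ r := by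
  refine le_antisymm (fun p hp => ?_) (minorSpan_pow_le_rankOneKernel r)
  obtain ⟨m, hm, hpm⟩ := exists_sub_orthogonal (minorSpan n ^ r) (minorSpan_fg.pow r) p
  obtain ⟨d, hd⟩ := exists_mem_degreeLE (p - m)
  have h : p - m ∈ orthogonalKernel n r d :=
    ⟨sub_mem hp (minorSpan_pow_le_rankOneKernel r hm), hd, hpm⟩
  rw [orthogonalKernel_eq_bot, Submodule.mem_bot, sub_eq_zero] at h
  exact h ▸ hm

end Main

section Interpolation

theorem IsPolyOfDegreeLE.eq_sum_lagrange {r : ℕ} {F : ℝ → ℝ} (hF : IsPolyOfDegreeLE r F) (t : ℝ) :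
    F t = ∑ k ∈ Finset.range (r + 1),
      F k * (Lagrange.basis (Finset.range (r + 1)) (fun k : ℕ => (k : ℝ)) k).eval t := by
  obtain ⟨q, hq, hqF⟩ := hF
  have hdeg : q.degree < (Finset.range (r + 1)).card := by
    rw [Finset.card_range]
    exact (Polynomial.natDegree_le_iff_degree_le.1 hq).trans_lt (by exact_mod_cast r.lt_succ_self)
  have h := Lagrange.eq_interpolate (s := Finset.range (r + 1)) (v := fun k : ℕ => (k : ℝ))
    Nat.cast_injective.injOn hdeg
  rw [hqF, congrArg (Polynomial.eval t) h, Lagrange.interpolate_apply, Polynomial.eval_finsetSum]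
  refine Finset.sum_congr rfl fun k _ => ?_
  rw [Polynomial.eval_mul, Polynomial.eval_C, hqF]

/-- A function of the variables in `s` which is a polynomial of degree at most `r` in each variable
separately is a polynomial. -/
theorem exists_eval_eq_of_forall_update {σ : Type*} [DecidableEq σ] {r : ℕ} (s : Finset σ)
    (F : (σ → ℝ) → ℝ) (hs : ∀ x y, (∀ i ∈ s, x i = y i) → F x = F y)
    (hF : ∀ x i, IsPolyOfDegreeLE r fun t => F (Function.update x i t)) :
    ∃ p : MvPolynomial σ ℝ, ∀ x, F x = eval x p := by
  induction s using Finset.induction_on generalizing F with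
  | empty => exact ⟨C (F 0), fun x => by rw [eval_C]; exact hs x 0 (by simp)⟩
  | insert a s ha ih =>
    have hk : ∀ k : ℕ, ∃ p : MvPolynomial σ ℝ, ∀ x, F (Function.update x a k) = eval x p := by
      refine fun k => ih _ (fun x y hxy => hs _ _ fun i hi => ?_) fun x i => ?_
      · rcases eq_or_ne i a with rfl | hia
        · simp
        · simp [hia, hxy i ((Finset.mem_insert.1 hi).resolve_left hia)]
      · rcases eq_or_ne i a with rfl | hia
        · simpa using IsPolyOfDegreeLE.const _
        · simpa only [Function.update_comm hia] using hF (Function.update x a k) i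
    choose p hp using hk
    refine ⟨∑ k ∈ Finset.range (r + 1), p k * Polynomial.aeval (X a)
      (Lagrange.basis (Finset.range (r + 1)) (fun k : ℕ => (k : ℝ)) k), fun x => ?_⟩
    have h := (hF x a).eq_sum_lagrange (x a)
    rw [Function.update_eq_self] at h
    rw [h, map_sum]
    refine Finset.sum_congr rfl fun k _ => ?_
    rw [map_mul, ← hp, ← MvPolynomial.coe_aeval_eq_eval, RingHom.coe_coe,
      ← Polynomial.aeval_algHom_apply, aeval_X, Polynomial.coe_aeval_eq_eval]

variable {n : ℕ}

/-- Vectors whose rank-one matrices span the symmetric matrices. -/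
def rankOneVec : Fin n ⊕ Fin n × Fin n → Fin n → ℝ :=
  Sum.elim (fun i => Pi.single i 1) fun ij => Pi.single ij.1 1 + Pi.single ij.2 1

theorem sum_rankOneVec_eq {A : Matrix (Fin n) (Fin n) ℝ} (hA : A.IsSymm) :
    ∑ s, (Sum.elim (fun k => -∑ j, A k j) (fun ij => A ij.1 ij.2 / 2) :
      Fin n ⊕ Fin n × Fin n → ℝ) s • vecMulVec (rankOneVec s) (rankOneVec s) = A := by
  ext k l
  have hA' : ∀ i j, A i j = A j i := fun i j => hA.apply j i
  simp only [Fintype.sum_sum_type, Fintype.sum_prod_type, rankOneVec, Sum.elim_inl, Sum.elim_inr,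
    Matrix.sum_apply, Matrix.smul_apply, vecMulVec_apply, smul_eq_mul,
    Pi.add_apply, Pi.single_apply, mul_add, Finset.sum_add_distrib, mul_ite, mul_one, mul_zero,
    Finset.sum_ite_eq, Finset.mem_univ, if_true, Finset.sum_ite_irrel, Finset.sum_const_zero]
  rcases eq_or_ne k l with rfl | hkl
  · simp only [if_true, ← Finset.sum_div, hA' _ k]
    ring
  · simp [hkl, hA' l k]

theorem exists_evalAt_eq_comp_symPart {r : ℕ} {f : Matrix (Fin n) (Fin n) ℝ → ℝ}
    (hf : ∀ A : Matrix (Fin n) (Fin n) ℝ, A.IsSymm → ∀ ξ : Fin n → ℝ,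
      IsPolyOfDegreeLE r fun t => f (A + t • vecMulVec ξ ξ)) :
    ∃ p, ∀ X, evalAt X p = f (symPart X) := by
  let Φ : (Fin n ⊕ Fin n × Fin n → ℝ) → Matrix (Fin n) (Fin n) ℝ := fun x =>
    ∑ s, x s • vecMulVec (rankOneVec s) (rankOneVec s)
  have hΦ : ∀ x, (Φ x).IsSymm := fun x => by
    rw [Matrix.IsSymm, transpose_sum]
    exact Finset.sum_congr rfl fun s _ => (isSymm_vecMulVec_self _).smul _
  have hupd : ∀ x s t, Φ (Function.update x s t) =
      Φ (Function.update x s 0) + t • vecMulVec (rankOneVec s) (rankOneVec s) := fun x s t => by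
    simp only [Φ]
    rw [← Finset.add_sum_erase _ _ (Finset.mem_univ s),
      ← Finset.add_sum_erase _ (fun s' => Function.update x s 0 s' • _) (Finset.mem_univ s),
      Function.update_self, Function.update_self, zero_smul, zero_add, add_comm]
    congr 1
    refine Finset.sum_congr rfl fun s' hs' => ?_
    rw [Function.update_of_ne (Finset.ne_of_mem_erase hs'),
      Function.update_of_ne (Finset.ne_of_mem_erase hs')]
  obtain ⟨p, hp⟩ := exists_eval_eq_of_forall_update (r := r) Finset.univ (fun x => f (Φ x))
    (fun x y hxy => by rw [funext fun i => hxy i (Finset.mem_univ i)]) fun x s => by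
      rw [funext fun t => congrArg f (hupd x s t)]
      exact hf _ (hΦ _) _
  let L : Fin n ⊕ Fin n × Fin n → MvPolynomial (Fin n × Fin n) ℝ :=
    Sum.elim (fun k => -∑ j, genSymm k j) fun ij => genSymm ij.1 ij.2 * C (1 / 2)
  refine ⟨aeval L p, fun X => ?_⟩
  have hgen : ∀ i j, evalAt X (genSymm i j) = symPart X i j := fun i j =>
    congrFun (congrFun (map_evalAt_genSymm X) i) j
  have hL : (fun s => evalAt X (L s)) =
      Sum.elim (fun k => -∑ j, symPart X k j) fun ij => symPart X ij.1 ij.2 / 2 := by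
    funext s
    rcases s with k | ij
    · simp [L, hgen]
    · simp only [L, Sum.elim_inr, map_mul, hgen, algHom_C]
      simp [div_eq_mul_inv]
  have hcomp : evalAt X (aeval L p) = eval (fun s => evalAt X (L s)) p := by
    rw [comp_aeval_apply, aeval_eq_eval]
  rw [hcomp, ← hp, hL]
  exact congrArg f (sum_rankOneVec_eq (isSymm_symPart X))

theorem exists_mem_minorSpan_pow_of_isPoly {r : ℕ} {f : Matrix (Fin n) (Fin n) ℝ → ℝ}
    (hf : ∀ A : Matrix (Fin n) (Fin n) ℝ, A.IsSymm → ∀ ξ : Fin n → ℝ,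
      IsPolyOfDegreeLE r fun t => f (A + t • vecMulVec ξ ξ)) :
    ∃ p ∈ minorSpan n ^ r, ∀ A : Matrix (Fin n) (Fin n) ℝ, A.IsSymm → f A = evalAt A p := by
  obtain ⟨p, hp⟩ := exists_evalAt_eq_comp_symPart hf
  refine ⟨p, ?_, fun A hA => by rw [hp, symPart_of_isSymm hA]⟩
  rw [← rankOneKernel_eq_minorSpan_pow]
  refine ⟨fun X => by rw [hp, hp, symPart_of_isSymm (isSymm_symPart X)], fun X ξ => ?_⟩
  simpa only [hp, symPart_add_smul_vecMulVec] using hf _ (isSymm_symPart X) ξ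

theorem exists_sum_prod_minors_of_mem {r : ℕ} {p : MvPolynomial (Fin n × Fin n) ℝ}
    (hp : p ∈ minorSpan n ^ r) : ∃ (N : ℕ) (c : Fin N → ℝ)
      (P : Fin N → Fin r → {P : Finset (Fin n) × Finset (Fin n) // P.1.card = P.2.card}),
      p = ∑ α, c α • ∏ j, genMinor ((P α j).1.1.orderEmbOfFin rfl)
        ((P α j).1.2.orderEmbOfFin (P α j).2.symm) := by
  rw [minorSpan, Submodule.span_pow, Submodule.mem_span_set'] at hp
  obtain ⟨N, c, g, rfl⟩ := hp
  have hg : ∀ α, ∃ P : Fin r →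
      {P : Finset (Fin n) × Finset (Fin n) // P.1.card = P.2.card},
      (g α : MvPolynomial (Fin n × Fin n) ℝ) = ∏ j, genMinor ((P j).1.1.orderEmbOfFin rfl)
        ((P j).1.2.orderEmbOfFin (P j).2.symm) := fun α => by
    obtain ⟨F, hF⟩ := Set.mem_pow.1 (g α).2
    choose P hP using fun j => (F j).2
    refine ⟨P, ?_⟩
    rw [← hF, List.prod_ofFn]
    exact Finset.prod_congr rfl fun j _ => (hP j).symm
  choose P hP using hg
  exact ⟨N, c, P, Finset.sum_congr rfl fun α _ => by rw [hP]⟩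

/-- Linear combinations of products of at most `r` minors lie in `minorSpan n ^ r`. -/
theorem sum_prod_minors_mem {r N : ℕ} (c : Fin N → ℝ) {m : Fin N → ℕ} (hm : ∀ α, m α ≤ r)
    {q : (α : Fin N) → Fin (m α) → MvPolynomial (Fin n × Fin n) ℝ}
    (hq : ∀ α j, q α j ∈ minorSpan n) : ∑ α, c α • ∏ j, q α j ∈ minorSpan n ^ r := by
  refine Submodule.sum_mem _ fun α _ => Submodule.smul_mem _ _ ?_
  refine pow_le_pow_right' (Submodule.one_le.2 one_mem_minorSpan) (hm α) ?_
  rw [← List.prod_ofFn]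
  refine Submodule.pow_subset_pow _ (Set.mem_pow.2 ⟨fun j => ⟨q α j, hq α j⟩, rfl⟩)

end Interpolation
end RankOneMinors

attribute [local instance] Matrix.normedAddCommGroup Matrix.normedSpace

/-- BGG characterisation of degree-`r` hypersurface sections, on the affine
chart: a smooth function `f` on `n × n` matrices restricts on every line through a
symmetric matrix in a rank-one direction `ξξᵀ` to a polynomial of degree at most `r`
if and only if, on symmetric matrices, `f` is a finite linear combination of products of
at most `r` minors. -/
theorem polynomial_on_rank_one_lines_iff_sum_of_products_of_minors
    (n r : ℕ) (hn : 1 ≤ n) (hr : 1 ≤ r)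
    (f : Matrix (Fin n) (Fin n) ℝ → ℝ) (hf : ContDiff ℝ (⊤ : ℕ∞) f) :
    (∀ A : Matrix (Fin n) (Fin n) ℝ, A.IsSymm → ∀ ξ : Fin n → ℝ,
        ∃ p : Polynomial ℝ, p.natDegree ≤ r ∧
          ∀ t : ℝ, f (A + t • Matrix.vecMulVec ξ ξ) = Polynomial.eval t p) ↔
    (∃ (N : ℕ) (c : Fin N → ℝ) (m : Fin N → ℕ),
        (∀ α, m α ≤ r) ∧
        ∃ (k : (α : Fin N) → Fin (m α) → ℕ)
          (I J : (α : Fin N) → Fin (m α) → Finset (Fin n))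
          (hI : ∀ α j, (I α j).card = k α j) (hJ : ∀ α j, (J α j).card = k α j),
          ∀ A : Matrix (Fin n) (Fin n) ℝ, A.IsSymm →
            f A = ∑ α, c α * ∏ j,
              (A.submatrix ((I α j).orderEmbOfFin (hI α j)) ((J α j).orderEmbOfFin (hJ α j))).det) := by
  open RankOneMinors in
  constructor
  · intro h
    obtain ⟨p, hp, hpf⟩ := exists_mem_minorSpan_pow_of_isPoly h
    obtain ⟨N, c, P, rfl⟩ := exists_sum_prod_minors_of_mem hp
    refine ⟨N, c, fun _ => r, fun _ => le_rfl, fun α j => (P α j).1.1.card,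
      fun α j => (P α j).1.1, fun α j => (P α j).1.2, fun _ _ => rfl,
      fun α j => (P α j).2.symm, fun A hA => ?_⟩
    rw [hpf A hA, map_sum]
    refine Finset.sum_congr rfl fun α _ => ?_
    rw [map_smul, smul_eq_mul, map_prod]
    simp only [evalAt_genMinor, symPart_of_isSymm hA]
  · rintro ⟨N, c, m, hm, k, I, J, hI, hJ, hf⟩ A hA ξ
    have hmem := minorSpan_pow_le_rankOneKernel r <|
      sum_prod_minors_mem c hm fun α j => genMinor_orderEmbOfFin_mem (hI α j) (hJ α j)
    obtain ⟨q, hq, hqt⟩ := hmem.2 A ξ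
    beta_reduce at hqt
    refine ⟨q, hq, fun t => ?_⟩
    have hsymm : (A + t • Matrix.vecMulVec ξ ξ).IsSymm :=
      hA.add ((isSymm_vecMulVec_self ξ).smul t)
    rw [← hqt, hf _ hsymm, map_sum]
    refine Finset.sum_congr rfl fun α _ => ?_
    rw [map_smul, smul_eq_mul, map_prod]
    simp only [evalAt_genMinor, symPart_of_isSymm hsymm]
end

section
/- Fix integers n ≥ 1 and r ≥ 1, and let f : Matrix(n,n,ℝ) → ℝ be a smooth function such that for every symmetric n×n real matrix A and every ξ ∈ ℝⁿ the function t ↦ f(A + t·ξξᵀ) is a polynomial function of degree at most r. Then there exists a real polynomial p in the n² matrix entries, of total degree at most n·r, such that f(A) = p(A) for every symmetric n×n real matrix A. Moreover the bound is saturated: the function f₀(A) = (det A)^r satisfies the hypothesis (for every symmetric A and every ξ ∈ ℝⁿ, t ↦ det(A + t·ξξᵀ)^r is a polynomial of degree at most r in t) and f₀ is a polynomial of total degree exactly n·r. -/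
attribute [local instance] Matrix.normedAddCommGroup Matrix.normedSpace

/-- A function of `m` real variables that is a polynomial of degree at most `r` in each variable
separately is a polynomial of total degree at most `m * r`. -/
theorem exists_mvPolynomial_of_separately_polynomial (r : ℕ) :
    ∀ (m : ℕ) (g : (Fin m → ℝ) → ℝ),
      (∀ (x : Fin m → ℝ) (i : Fin m), ∃ p : Polynomial ℝ, p.natDegree ≤ r ∧
        ∀ t : ℝ, g (Function.update x i t) = p.eval t) →
      ∃ Q : MvPolynomial (Fin m) ℝ, Q.totalDegree ≤ m * r ∧
        ∀ x, g x = MvPolynomial.eval x Q := by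
  intro m
  induction m with
  | zero =>
    intro g _
    refine ⟨MvPolynomial.C (g 0), by simp, fun x => ?_⟩
    rw [MvPolynomial.eval_C, Subsingleton.elim x 0]
  | succ m ih =>
    intro g hg
    have hslice : ∀ k : ℕ, ∃ Q : MvPolynomial (Fin m) ℝ, Q.totalDegree ≤ m * r ∧
        ∀ x : Fin m → ℝ, g (Fin.cons (k : ℝ) x) = MvPolynomial.eval x Q := by
      intro k
      refine ih (fun x => g (Fin.cons (k : ℝ) x)) fun x i => ?_
      obtain ⟨p, hp, h⟩ := hg (Fin.cons (k : ℝ) x) i.succ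
      exact ⟨p, hp, fun t => by rw [← h t, Fin.cons_update]⟩
    choose Q hQdeg hQ using hslice
    have hinj : Set.InjOn (fun k : ℕ => (k : ℝ)) (Finset.range (r + 1) : Finset ℕ) :=
      fun a _ b _ hab => Nat.cast_injective hab
    let L : ℕ → Polynomial ℝ := Lagrange.basis (Finset.range (r + 1)) (fun k : ℕ => (k : ℝ))
    have hL : ∀ k ∈ Finset.range (r + 1), (L k).natDegree ≤ r := by
      intro k hk
      have h := Lagrange.natDegree_basis hinj hk
      rw [Finset.card_range] at h
      exact h.le
    refine ⟨∑ k ∈ Finset.range (r + 1), MvPolynomial.rename Fin.succ (Q k) *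
      Polynomial.aeval (MvPolynomial.X 0) (L k), ?_, fun x => ?_⟩
    · refine MvPolynomial.totalDegree_finsetSum_le fun k hk => ?_
      refine (MvPolynomial.totalDegree_mul _ _).trans ?_
      rw [Nat.succ_mul]
      refine add_le_add ((MvPolynomial.totalDegree_rename_le _ _).trans (hQdeg k)) ?_
      rw [Polynomial.aeval_eq_sum_range]
      refine MvPolynomial.totalDegree_finsetSum_le fun i hi => ?_
      refine (MvPolynomial.totalDegree_smul_le _ _).trans ?_
      rw [MvPolynomial.totalDegree_X_pow]
      exact (Nat.lt_succ_iff.mp (Finset.mem_range.mp hi)).trans (hL k hk)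
    · obtain ⟨p, hp, h⟩ := hg x 0
      have hpt : ∀ t : ℝ, g (Fin.cons t (Fin.tail x)) = p.eval t := by
        intro t
        rw [← h t, ← Fin.cons_self_tail x, Fin.update_cons_zero, Fin.tail_cons]
      have hlt : p.degree < (Finset.range (r + 1)).card := by
        rw [Finset.card_range]
        exact lt_of_le_of_lt Polynomial.degree_le_natDegree
          (by exact_mod_cast Nat.lt_succ_of_le hp)
      have hp_eq := Lagrange.eq_interpolate hinj hlt
      have hev : ∀ (q : Polynomial ℝ), MvPolynomial.eval x
          (Polynomial.aeval (MvPolynomial.X 0 : MvPolynomial (Fin (m + 1)) ℝ) q) =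
            q.eval (x 0) := by
        intro q
        rw [Polynomial.aeval_def, Polynomial.hom_eval₂, MvPolynomial.eval_X,
          MvPolynomial.algebraMap_eq,
          show (MvPolynomial.eval x).comp MvPolynomial.C = RingHom.id ℝ from
            RingHom.ext fun c => MvPolynomial.eval_C c]
        rfl
      calc g x = p.eval (x 0) := by rw [← hpt, Fin.cons_self_tail]
        _ = _ := by
          rw [hp_eq, Lagrange.interpolate_apply, Polynomial.eval_finsetSum, map_sum]
          refine Finset.sum_congr rfl fun k _ => ?_
          rw [map_mul, MvPolynomial.eval_rename, hev, Polynomial.eval_mul, Polynomial.eval_C,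
            ← hpt k, hQ]
          rfl

/-- The restriction of a polynomial to the line `t ↦ t • a` has the values of the homogeneous
components at `a` as its coefficients. -/
theorem coeff_aeval_C_mul_X {σ : Type*} (a : σ → ℝ) (P : MvPolynomial σ ℝ) (k : ℕ) :
    (MvPolynomial.aeval (fun i => Polynomial.C (a i) * Polynomial.X) P).coeff k =
      MvPolynomial.eval a (MvPolynomial.homogeneousComponent k P) := by
  induction P using MvPolynomial.induction_on' with
  | add p q hp hq => simp only [map_add, Polynomial.coeff_add, hp, hq]
  | monomial u c =>
    rw [MvPolynomial.homogeneousComponent_of_mem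
      ((MvPolynomial.mem_homogeneousSubmodule _ _).mpr
        (MvPolynomial.isHomogeneous_monomial c (rfl : u.degree = u.degree)))]
    rw [MvPolynomial.aeval_monomial]
    simp only [mul_pow, Finsupp.prod_mul]
    have h1 : (u.prod fun _ e => (Polynomial.X : Polynomial ℝ) ^ e) =
        Polynomial.X ^ u.degree := by
      rw [Finsupp.prod, Finset.prod_pow_eq_pow_sum]
      rfl
    have h2 : (u.prod fun i e => (Polynomial.C (a i)) ^ e) =
        Polynomial.C (u.prod fun i e => a i ^ e) := by
      simp [Finsupp.prod, map_prod]
    rw [h1, h2, Polynomial.algebraMap_eq, ← mul_assoc, ← Polynomial.C_mul,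
      Polynomial.coeff_C_mul_X_pow]
    split_ifs with h <;> simp [MvPolynomial.eval_monomial]

/-- Evaluating the restriction of a polynomial to the line `t ↦ t • a`. -/
theorem eval_aeval_C_mul_X {σ : Type*} (a : σ → ℝ) (P : MvPolynomial σ ℝ) (t : ℝ) :
    (MvPolynomial.aeval (fun i => Polynomial.C (a i) * Polynomial.X) P).eval t =
      MvPolynomial.eval (fun i => t * a i) P := by
  induction P using MvPolynomial.induction_on with
  | C c => simp
  | add p q hp hq => simp only [map_add, Polynomial.eval_add, hp, hq]
  | mul_X p i hp => simp only [map_mul, Polynomial.eval_mul, hp, MvPolynomial.aeval_X,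
      Polynomial.eval_C, Polynomial.eval_X, MvPolynomial.eval_X]; ring

/-- A real symmetric matrix is a linear combination of `n` rank-one matrices `ξξᵀ`. -/
theorem Matrix.IsSymm.exists_eq_sum_smul_vecMulVec {n : ℕ} {A : Matrix (Fin n) (Fin n) ℝ}
    (hA : A.IsSymm) :
    ∃ (c : Fin n → ℝ) (ξ : Fin n → Fin n → ℝ), A = ∑ k, c k • vecMulVec (ξ k) (ξ k) := by
  have hH : A.IsHermitian := by
    rw [IsHermitian, conjTranspose_eq_transpose_of_trivial]
    exact hA
  refine ⟨hH.eigenvalues, fun k i => (hH.eigenvectorUnitary : Matrix (Fin n) (Fin n) ℝ) i k, ?_⟩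
  have h := hH.spectral_theorem
  rw [Unitary.conjStarAlgAut_apply] at h
  ext i j
  have hij := congrFun (congrFun h i) j
  rw [hij, mul_apply, sum_apply]
  refine Finset.sum_congr rfl fun k _ => ?_
  rw [mul_diagonal]
  simp only [Function.comp_apply, RCLike.ofReal_real_eq_id, id, star_apply, star_trivial,
    smul_apply, vecMulVec_apply, smul_eq_mul]
  ring

/-- A symmetric matrix in terms of the rank-one matrices `(eᵢ + eⱼ)(eᵢ + eⱼ)ᵀ`. -/
theorem Matrix.IsSymm.eq_sum_smul_vecMulVec_single {n : ℕ} {A : Matrix (Fin n) (Fin n) ℝ}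
    (hA : A.IsSymm) :
    A = ∑ k : Fin n × Fin n,
      (A k.1 k.2 / 2 - if k.1 = k.2 then (∑ l, A k.1 l) / 4 else 0) •
        vecMulVec (Pi.single k.1 1 + Pi.single k.2 1) (Pi.single k.1 1 + Pi.single k.2 1) := by
  ext i j
  rw [sum_apply, Fintype.sum_prod_type]
  have hterm : ∀ k l : Fin n,
      ((A k l / 2 - if k = l then (∑ l', A k l') / 4 else 0) •
        vecMulVec (Pi.single k 1 + Pi.single l 1) (Pi.single k 1 + Pi.single l 1) :
          Matrix (Fin n) (Fin n) ℝ) i j =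
      (if i = k then if j = k then A k l / 2 else 0 else 0) +
      (if i = k then if j = l then A k l / 2 else 0 else 0) +
      (if i = l then if j = k then A k l / 2 else 0 else 0) +
      (if i = l then if j = l then A k l / 2 else 0 else 0) -
      (if k = l then if i = k then if j = k then ∑ l', A k l' else 0 else 0 else 0) := by
    intro k l
    simp only [smul_apply, vecMulVec_apply, Pi.add_apply, Pi.single_apply, smul_eq_mul]
    split_ifs <;> first | (subst_vars; contradiction) | (subst_vars; ring)
  have hrow : ∑ x, A x i / 2 = ∑ x, A i x / 2 :=
    Finset.sum_congr rfl fun x _ => by rw [hA.apply]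
  simp only [hterm, Finset.sum_add_distrib, Finset.sum_sub_distrib, Finset.sum_ite_irrel,
    Finset.sum_const_zero, Finset.sum_ite_eq, Finset.mem_univ, if_true]
  rw [hrow, ← Finset.sum_div, hA.apply i j]
  split_ifs <;> ring

/-- The determinant is affine along rank-one directions. -/
theorem Matrix.exists_det_add_smul_vecMulVec {n : ℕ} (A : Matrix (Fin n) (Fin n) ℝ) (u v : Fin n → ℝ) :
    ∃ a b : ℝ, ∀ t : ℝ, (A + t • vecMulVec u v).det = a + t * b := by
  let M : (Fin n ⊕ Unit → ℝ) → Matrix (Fin n ⊕ Unit) (Fin n ⊕ Unit) ℝ := fun w =>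
    (fromBlocks A (replicateCol Unit u) 0 1).updateRow (Sum.inr ()) w
  refine ⟨(M (Sum.elim 0 1 : Fin n ⊕ Unit → ℝ)).det, (M (Sum.elim (-v) 0 : Fin n ⊕ Unit → ℝ)).det, fun t => ?_⟩
  have h1 : A + t • vecMulVec u v =
      A - replicateCol Unit u * replicateRow Unit (-(t • v)) := by
    ext i j
    simp [mul_apply, vecMulVec_apply]
    ring
  have h2 : fromBlocks A (replicateCol Unit u) (replicateRow Unit (-(t • v))) 1 =
      M ((Sum.elim 0 1 : Fin n ⊕ Unit → ℝ) + t • (Sum.elim (-v) 0 : Fin n ⊕ Unit → ℝ)) := by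
    ext (i | i) (j | j) <;> simp [M, updateRow_apply]
  rw [h1, ← det_fromBlocks_one₂₂, h2]
  simp only [M, det_updateRow_add, det_updateRow_smul]

/-- A function that is a polynomial of degree at most `r` along rank-one directions is a polynomial
in the coefficients of any linear combination of `m` rank-one matrices. -/
theorem exists_mvPolynomial_sum_smul_vecMulVec {n r : ℕ} {f : Matrix (Fin n) (Fin n) ℝ → ℝ}
    (hf : ∀ A : Matrix (Fin n) (Fin n) ℝ, A.IsSymm → ∀ ξ : Fin n → ℝ,
      ∃ p : Polynomial ℝ, p.natDegree ≤ r ∧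
        ∀ t : ℝ, f (A + t • Matrix.vecMulVec ξ ξ) = Polynomial.eval t p)
    {m : ℕ} (ξ : Fin m → Fin n → ℝ) :
    ∃ Q : MvPolynomial (Fin m) ℝ, Q.totalDegree ≤ m * r ∧
      ∀ c : Fin m → ℝ, f (∑ k, c k • Matrix.vecMulVec (ξ k) (ξ k)) = MvPolynomial.eval c Q := by
  refine exists_mvPolynomial_of_separately_polynomial r m _ fun x i => ?_
  obtain ⟨p, hp, h⟩ := hf (∑ k ∈ Finset.univ.erase i, x k • Matrix.vecMulVec (ξ k) (ξ k)) (by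
    rw [Matrix.IsSymm, Matrix.transpose_sum]
    simp [Matrix.transpose_smul, Matrix.transpose_vecMulVec]) (ξ i)
  refine ⟨p, hp, fun t => ?_⟩
  rw [← h t, ← Finset.sum_erase_add _ _ (Finset.mem_univ i), Function.update_self]
  congr 2
  refine Finset.sum_congr rfl fun k hk => ?_
  rw [Function.update_of_ne (Finset.ne_of_mem_erase hk)]

/-- A function that is polynomial along rank-one directions agrees with a polynomial in the matrix
entries on symmetric matrices. -/
theorem exists_mvPolynomial_eq_on_isSymm {n r : ℕ} {f : Matrix (Fin n) (Fin n) ℝ → ℝ}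
    (hf : ∀ A : Matrix (Fin n) (Fin n) ℝ, A.IsSymm → ∀ ξ : Fin n → ℝ,
      ∃ p : Polynomial ℝ, p.natDegree ≤ r ∧
        ∀ t : ℝ, f (A + t • Matrix.vecMulVec ξ ξ) = Polynomial.eval t p) :
    ∃ P : MvPolynomial (Fin n × Fin n) ℝ, ∀ A : Matrix (Fin n) (Fin n) ℝ, A.IsSymm →
      f A = MvPolynomial.eval (fun ij => A ij.1 ij.2) P := by
  let e := Fintype.equivFin (Fin n × Fin n)
  let ξ : Fin n × Fin n → Fin n → ℝ := fun k => Pi.single k.1 1 + Pi.single k.2 1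
  obtain ⟨Q, -, hQ⟩ := exists_mvPolynomial_sum_smul_vecMulVec hf (fun k => ξ (e.symm k))
  let c : Fin n × Fin n → MvPolynomial (Fin n × Fin n) ℝ := fun k =>
    MvPolynomial.C (1 / 2) * MvPolynomial.X k -
      if k.1 = k.2 then MvPolynomial.C (1 / 4) * ∑ l, MvPolynomial.X (k.1, l) else 0
  refine ⟨MvPolynomial.bind₁ (fun k => c (e.symm k)) Q, fun A hA => ?_⟩
  have hc : ∀ k, MvPolynomial.eval (fun ij => A ij.1 ij.2) (c k) =
      A k.1 k.2 / 2 - if k.1 = k.2 then (∑ l, A k.1 l) / 4 else 0 := by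
    intro k
    simp only [c, map_sub, map_mul, MvPolynomial.eval_C, MvPolynomial.eval_X, apply_ite
      (MvPolynomial.eval fun ij : Fin n × Fin n => A ij.1 ij.2), map_sum, map_zero]
    congr 1
    · ring
    · split_ifs <;> ring
  have key : MvPolynomial.eval (fun ij => A ij.1 ij.2)
      (MvPolynomial.bind₁ (fun k => c (e.symm k)) Q) = MvPolynomial.eval
        (fun k => MvPolynomial.eval (fun ij => A ij.1 ij.2) (c (e.symm k))) Q := by
    simp only [← MvPolynomial.aeval_eq_eval, MvPolynomial.aeval_bind₁]
  rw [key, ← hQ]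
  congr 1
  simp only [hc]
  rw [Equiv.sum_comp e.symm (fun k : Fin n × Fin n =>
    (A k.1 k.2 / 2 - if k.1 = k.2 then (∑ l, A k.1 l) / 4 else 0) •
      Matrix.vecMulVec (ξ k) (ξ k))]
  exact hA.eq_sum_smul_vecMulVec_single

/-- A function that is a polynomial of degree at most `r` along rank-one directions is a polynomial
of degree at most `n * r` on every line through the origin. -/
theorem exists_polynomial_smul_of_isSymm {n r : ℕ} {f : Matrix (Fin n) (Fin n) ℝ → ℝ}
    (hf : ∀ A : Matrix (Fin n) (Fin n) ℝ, A.IsSymm → ∀ ξ : Fin n → ℝ,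
      ∃ p : Polynomial ℝ, p.natDegree ≤ r ∧
        ∀ t : ℝ, f (A + t • Matrix.vecMulVec ξ ξ) = Polynomial.eval t p)
    {A : Matrix (Fin n) (Fin n) ℝ} (hA : A.IsSymm) :
    ∃ p : Polynomial ℝ, p.natDegree ≤ n * r ∧ ∀ t : ℝ, f (t • A) = p.eval t := by
  obtain ⟨c, ξ, h⟩ := hA.exists_eq_sum_smul_vecMulVec
  obtain ⟨Q, hQdeg, hQ⟩ := exists_mvPolynomial_sum_smul_vecMulVec hf ξ
  refine ⟨MvPolynomial.aeval (fun i => Polynomial.C (c i) * Polynomial.X) Q, ?_, fun t => ?_⟩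
  · simpa using MvPolynomial.aeval_natDegree_le Q hQdeg _
      (fun i => (Polynomial.natDegree_C_mul_le _ _).trans Polynomial.natDegree_X_le)
  · rw [eval_aeval_C_mul_X, ← hQ, h, Finset.smul_sum]
    simp only [smul_smul]

/-- a smooth function on `n × n` matrices which restricts to a polynomial
of degree at most `r` on every line through a symmetric matrix in a rank-one direction
`ξξᵀ` agrees on symmetric matrices with a polynomial in the matrix entries of total
degree at most `n·r`; moreover the bound is saturated by `f₀(A) = (det A)^r`, which
satisfies the hypothesis, agrees on symmetric matrices with a polynomial of total degree
exactly `n·r`, and with no polynomial of smaller total degree. -/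
theorem solutions_of_bgg_operator_are_polynomials_of_degree_nr
    (n r : ℕ) (hn : 1 ≤ n) (hr : 1 ≤ r) :
    (∀ f : Matrix (Fin n) (Fin n) ℝ → ℝ, ContDiff ℝ (⊤ : ℕ∞) f →
      (∀ A : Matrix (Fin n) (Fin n) ℝ, A.IsSymm → ∀ ξ : Fin n → ℝ,
          ∃ p : Polynomial ℝ, p.natDegree ≤ r ∧
            ∀ t : ℝ, f (A + t • Matrix.vecMulVec ξ ξ) = Polynomial.eval t p) →
      ∃ P : MvPolynomial (Fin n × Fin n) ℝ, P.totalDegree ≤ n * r ∧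
        ∀ A : Matrix (Fin n) (Fin n) ℝ, A.IsSymm →
          f A = MvPolynomial.eval (fun ij => A ij.1 ij.2) P) ∧
    (∀ A : Matrix (Fin n) (Fin n) ℝ, A.IsSymm → ∀ ξ : Fin n → ℝ,
        ∃ p : Polynomial ℝ, p.natDegree ≤ r ∧
          ∀ t : ℝ, (A + t • Matrix.vecMulVec ξ ξ).det ^ r = Polynomial.eval t p) ∧
    (∃ P : MvPolynomial (Fin n × Fin n) ℝ, P.totalDegree = n * r ∧
        ∀ A : Matrix (Fin n) (Fin n) ℝ, A.IsSymm →
          A.det ^ r = MvPolynomial.eval (fun ij => A ij.1 ij.2) P) ∧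
    (∀ P : MvPolynomial (Fin n × Fin n) ℝ,
        (∀ A : Matrix (Fin n) (Fin n) ℝ, A.IsSymm →
          A.det ^ r = MvPolynomial.eval (fun ij => A ij.1 ij.2) P) →
        n * r ≤ P.totalDegree) := by
  refine ⟨fun f _ hf => ?_, fun A _ ξ => ?_, ?_, fun P hP => ?_⟩
  · obtain ⟨P, hP⟩ := exists_mvPolynomial_eq_on_isSymm hf
    refine ⟨∑ k ∈ Finset.range (n * r + 1), MvPolynomial.homogeneousComponent k P, ?_,
      fun A hA => ?_⟩
    · refine MvPolynomial.totalDegree_finsetSum_le fun k hk => ?_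
      exact (MvPolynomial.homogeneousComponent_isHomogeneous k P).totalDegree_le.trans
        (Nat.lt_succ_iff.mp (Finset.mem_range.mp hk))
    · obtain ⟨p, hp, h⟩ := exists_polynomial_smul_of_isSymm hf hA
      have hpP : p = MvPolynomial.aeval
          (fun ij : Fin n × Fin n => Polynomial.C (A ij.1 ij.2) * Polynomial.X) P := by
        refine Polynomial.funext fun t => ?_
        rw [← h t, hP _ (hA.smul t), eval_aeval_C_mul_X]
        rfl
      rw [← one_smul ℝ A, h, Polynomial.eval_eq_sum_range' (Nat.lt_succ_of_le hp), map_sum,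
        one_smul]
      refine Finset.sum_congr rfl fun k _ => ?_
      rw [hpP, coeff_aeval_C_mul_X, one_pow, mul_one]
  · obtain ⟨a, b, h⟩ := Matrix.exists_det_add_smul_vecMulVec A ξ ξ
    refine ⟨(Polynomial.C b * Polynomial.X + Polynomial.C a) ^ r, ?_, fun t => ?_⟩
    · exact (Polynomial.natDegree_pow_le_of_le r Polynomial.natDegree_linear_le).trans
        (mul_one r).le
    · rw [h t]
      simp only [Polynomial.eval_pow, Polynomial.eval_add, Polynomial.eval_mul,
        Polynomial.eval_C, Polynomial.eval_X]
      ring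
  · refine ⟨(Matrix.mvPolynomialX (Fin n) (Fin n) ℝ).det ^ r, ?_, fun A _ => ?_⟩
    · have hhom : (Matrix.mvPolynomialX (Fin n) (Fin n) ℝ).det.IsHomogeneous n := by
        rw [Matrix.det_apply]
        refine MvPolynomial.IsHomogeneous.sum _ _ _ fun σ _ => ?_
        have hprod := MvPolynomial.IsHomogeneous.prod Finset.univ
          (fun i => Matrix.mvPolynomialX (Fin n) (Fin n) ℝ (σ i) i) (fun _ => 1)
          (fun i _ => MvPolynomial.isHomogeneous_X ℝ (σ i, i))
        rw [Finset.sum_const, Finset.card_univ, Fintype.card_fin, smul_eq_mul, mul_one] at hprod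
        rcases Int.units_eq_one_or (Equiv.Perm.sign σ) with h | h <;> rw [h]
        · rwa [one_smul]
        · rw [Units.neg_smul, one_smul]
          exact hprod.neg
      exact (hhom.pow r).totalDegree
        (pow_ne_zero r (Matrix.det_mvPolynomialX_ne_zero (Fin n) ℝ))
    · rw [map_pow, Matrix.eval_det_mvPolynomialX]
      rfl
  · let q : Polynomial ℝ := MvPolynomial.aeval (fun ij : Fin n × Fin n =>
      Polynomial.C ((1 : Matrix (Fin n) (Fin n) ℝ) ij.1 ij.2) * Polynomial.X) P
    have hq : q = Polynomial.X ^ (n * r) := by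
      refine Polynomial.funext fun t => ?_
      have h := hP (t • 1) (Matrix.isSymm_one.smul t)
      rw [Matrix.det_smul, Matrix.det_one, mul_one, Fintype.card_fin, ← pow_mul] at h
      rw [Polynomial.eval_pow, Polynomial.eval_X, h, eval_aeval_C_mul_X]
      rfl
    have hdeg : q.natDegree ≤ P.totalDegree * 1 := MvPolynomial.aeval_natDegree_le P le_rfl _
      (fun i => (Polynomial.natDegree_C_mul_le _ _).trans Polynomial.natDegree_X_le)
    rwa [hq, Polynomial.natDegree_X_pow, mul_one] at hdeg
end
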